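/- Assume (F), (W) and (P2). Suppose ρ̄<ρ_R<ρ_L, f(ρ_R)>p(ρ_L−)≥f(ρ_L)≥p(ρ_L+) and p(ρ_L−)≠p(ρ_L+) (case (NNN5)). Then for each p̄∈{p(ρ_L+), f(ρ_L), p(ρ_L−)} there exist T>0 and an entropy weak solution ρ on [0,T) of the constrained Riemann problem with non-local constraint such that f(ρ(t,0−))=f(ρ(t,0+))=p̄ for a.e. t∈(0,T); in particular there exist at least two entropy weak solutions that do not coincide a.e. on (0,τ)×ℝ for any small τ>0. -/

import Mathlib

open MeasureTheory Set Filter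

namespace CRP

noncomputable section

/-- Smooth compactly supported test functions on `ℝ²`. -/
def TestFn (φ : ℝ × ℝ → ℝ) : Prop :=
  ContDiff ℝ (⊤ : ℕ∞) φ ∧ HasCompactSupport φ

/-- Partial derivative of a test function in the first (time) variable. -/
def pdT (φ : ℝ × ℝ → ℝ) (z : ℝ × ℝ) : ℝ := fderiv ℝ φ z (1, 0)

/-- Partial derivative of a test function in the second (space) variable. -/
def pdX (φ : ℝ × ℝ → ℝ) (z : ℝ × ℝ) : ℝ := fderiv ℝ φ z (0, 1)

/-- Assumption (F): `f : [0,R] → [0,∞)` is Lipschitz, `f 0 = 0 = f R`, and there is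
`ρb ∈ (0,R)` with `f' ρ * (ρb - ρ) > 0` for a.e. `ρ ∈ [0,R]`. -/
def AF (R ρb : ℝ) (f : ℝ → ℝ) : Prop :=
  0 < R ∧ (∃ L : NNReal, LipschitzOnWith L f (Icc 0 R)) ∧
    (∀ x ∈ Icc (0:ℝ) R, 0 ≤ f x) ∧ f 0 = 0 ∧ f R = 0 ∧ ρb ∈ Ioo 0 R ∧
    (∀ᵐ x ∂(volume.restrict (Icc (0:ℝ) R)), deriv f x * (ρb - x) > 0)

/-- Assumption (W): `w` is a nonnegative non-decreasing weight on `ℝ₋` with unit integral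
and support in `[-i_w, 0]`. -/
def AW (w : ℝ → ℝ) : Prop :=
  (∀ x ≤ (0:ℝ), 0 ≤ w x) ∧ MonotoneOn w (Iic 0) ∧
    (∫ x in Iic (0:ℝ), w x) = 1 ∧ ∃ iw : ℝ, 0 < iw ∧ ∀ x ≤ -iw, w x = 0

/-- Assumption (P2): `p : [0,R] → (0, fmax]` is non-increasing and piecewise constant
with finitely many jumps (equivalently, it has finitely many values). -/
def AP2 (R fmax : ℝ) (p : ℝ → ℝ) : Prop :=
  AntitoneOn p (Icc 0 R) ∧ (∀ ξ ∈ Icc (0:ℝ) R, p ξ ∈ Ioc 0 fmax) ∧ (p '' Icc 0 R).Finite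

/-- The left limit `p(ξ−)` of a non-increasing piecewise constant `p` on `[0,R]`,
with the convention `p(0−) = p 0`. -/
def pminus (p : ℝ → ℝ) (ξ : ℝ) : ℝ := if ξ ≤ 0 then p 0 else sInf (p '' Ico 0 ξ)

/-- The right limit `p(ξ+)` of a non-increasing piecewise constant `p` on `[0,R]`,
with the convention `p(R+) = p R`. -/
def pplus (R : ℝ) (p : ℝ → ℝ) (ξ : ℝ) : ℝ := if R ≤ ξ then p R else sSup (p '' Ioc ξ R)

/-- `γ` is the left measure-theoretic trace of `ρ` at `x = 0`. -/
def LeftTraceAt (ρ : ℝ → ℝ → ℝ) (γ : ℝ → ℝ) : Prop :=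
  ∀ φ : ℝ × ℝ → ℝ, TestFn φ →
    Tendsto (fun ε : ℝ => (1 / ε) * ∫ t in Ioi (0:ℝ), ∫ x in Ioo (-ε) (0:ℝ),
        |ρ t x - γ t| * φ (t, x)) (nhdsWithin 0 (Ioi 0)) (nhds 0)

/-- `γ` is the right measure-theoretic trace of `ρ` at `x = 0`. -/
def RightTraceAt (ρ : ℝ → ℝ → ℝ) (γ : ℝ → ℝ) : Prop :=
  ∀ φ : ℝ × ℝ → ℝ, TestFn φ →
    Tendsto (fun ε : ℝ => (1 / ε) * ∫ t in Ioi (0:ℝ), ∫ x in Ioo (0:ℝ) ε,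
        |ρ t x - γ t| * φ (t, x)) (nhdsWithin 0 (Ioi 0)) (nhds 0)

/-- The constrained entropy inequality (i), with constraint level `q`, initial datum `ρ0`,
tested on all nonnegative test functions. -/
def EntIneq (R fmax : ℝ) (f q ρ0 : ℝ → ℝ) (ρ : ℝ → ℝ → ℝ) : Prop :=
  ∀ φ : ℝ × ℝ → ℝ, TestFn φ → (∀ z, 0 ≤ φ z) → ∀ k ∈ Icc (0:ℝ) R,
    0 ≤ (∫ t in Ioi (0:ℝ), ∫ x : ℝ,
          (|ρ t x - k| * pdT φ (t, x) +
            Real.sign (ρ t x - k) * (f (ρ t x) - f k) * pdX φ (t, x))) +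
        2 * (∫ t in Ioi (0:ℝ), (1 - q t / fmax) * f k * φ (t, 0)) +
        ∫ x : ℝ, |ρ0 x - k| * φ (0, x)

/-- The constrained entropy inequality (i) on the time interval `[0,T)`: only test
functions supported in `(-∞,T) × ℝ` are used. -/
def EntIneqOn (R fmax T : ℝ) (f q ρ0 : ℝ → ℝ) (ρ : ℝ → ℝ → ℝ) : Prop :=
  ∀ φ : ℝ × ℝ → ℝ, TestFn φ → (∀ z, 0 ≤ φ z) →
    tsupport φ ⊆ Iio T ×ˢ (univ : Set ℝ) → ∀ k ∈ Icc (0:ℝ) R,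
    0 ≤ (∫ t in Ioi (0:ℝ), ∫ x : ℝ,
          (|ρ t x - k| * pdT φ (t, x) +
            Real.sign (ρ t x - k) * (f (ρ t x) - f k) * pdX φ (t, x))) +
        2 * (∫ t in Ioi (0:ℝ), (1 - q t / fmax) * f k * φ (t, 0)) +
        ∫ x : ℝ, |ρ0 x - k| * φ (0, x)

/-- Basic regularity required of solutions: measurability, values in `[0,R]`, and
continuity in time with values in `L¹loc` (on compact sets `[-r,r]`). -/
def RegSol (R : ℝ) (ρ : ℝ → ℝ → ℝ) : Prop :=
  Measurable (Function.uncurry ρ) ∧ (∀ t x, ρ t x ∈ Icc (0:ℝ) R) ∧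
    ∀ r : ℝ, 0 < r → ∀ s : ℝ, 0 ≤ s →
      Tendsto (fun t => ∫ x in Icc (-r) r, |ρ t x - ρ s x|) (nhdsWithin s (Ici 0)) (nhds 0)

/-- `ρ`, with traces `γm`, `γp` at `x = 0`, satisfies the constrained entropy
inequalities with constraint level `q : (0,∞) → [0,fmax]` and initial datum `ρ0`. -/
def CEI (R fmax : ℝ) (f q ρ0 : ℝ → ℝ) (ρ : ℝ → ℝ → ℝ) (γm γp : ℝ → ℝ) : Prop :=
  RegSol R ρ ∧ (∀ t, q t ∈ Icc (0:ℝ) fmax) ∧ EntIneq R fmax f q ρ0 ρ ∧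
    LeftTraceAt ρ γm ∧ RightTraceAt ρ γp ∧
    (∀ᵐ t ∂(volume.restrict (Ioi (0:ℝ))), f (γm t) ≤ q t ∧ f (γp t) ≤ q t)

/-- Same as `CEI`, but on the time interval `[0,T)`. -/
def CEIOn (R fmax T : ℝ) (f q ρ0 : ℝ → ℝ) (ρ : ℝ → ℝ → ℝ) (γm γp : ℝ → ℝ) : Prop :=
  RegSol R ρ ∧ (∀ t, q t ∈ Icc (0:ℝ) fmax) ∧ EntIneqOn R fmax T f q ρ0 ρ ∧
    LeftTraceAt ρ γm ∧ RightTraceAt ρ γp ∧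
    (∀ᵐ t ∂(volume.restrict (Ioo (0:ℝ) T)), f (γm t) ≤ q t ∧ f (γp t) ≤ q t)

/-- The weighted average `ξ(t) = ∫_{ℝ₋} w x * ρ t x dx`. -/
def wAvg (w : ℝ → ℝ) (ρ : ℝ → ℝ → ℝ) (t : ℝ) : ℝ := ∫ x in Iic (0:ℝ), w x * ρ t x

/-- Entropy weak solution of the Cauchy problem with non-local point constraint given by
the (possibly multivalued, filled-in) piecewise constant `p`: there is a constraint level
`q` with `q t ∈ P(ξ(t)) = [p(ξ(t)+), p(ξ(t)−)]` a.e. such that `ρ` satisfies the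
constrained entropy inequalities with constraint level `q`. -/
def EWSol (R fmax : ℝ) (f w p ρ0 : ℝ → ℝ) (ρ : ℝ → ℝ → ℝ) (γm γp : ℝ → ℝ) : Prop :=
  ∃ q : ℝ → ℝ, CEI R fmax f q ρ0 ρ γm γp ∧
    ∀ᵐ t ∂(volume.restrict (Ioi (0:ℝ))),
      q t ∈ Icc (pplus R p (wAvg w ρ t)) (pminus p (wAvg w ρ t))

/-- Entropy weak solution with non-local constraint on the time interval `[0,T)`. -/
def EWSolOn (R fmax T : ℝ) (f w p ρ0 : ℝ → ℝ) (ρ : ℝ → ℝ → ℝ) (γm γp : ℝ → ℝ) : Prop :=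
  ∃ q : ℝ → ℝ, CEIOn R fmax T f q ρ0 ρ γm γp ∧
    ∀ᵐ t ∂(volume.restrict (Ioo (0:ℝ) T)),
      q t ∈ Icc (pplus R p (wAvg w ρ t)) (pminus p (wAvg w ρ t))

/-- The Riemann initial datum. -/
def riem (ρL ρR : ℝ) (x : ℝ) : ℝ := if x < 0 then ρL else ρR

/-- `ρ1 = ρ2` a.e. on `(0,T) × ℝ`. -/
def aeEqOn (T : ℝ) (ρ1 ρ2 : ℝ → ℝ → ℝ) : Prop :=
  ∀ᵐ z ∂((volume : Measure (ℝ × ℝ)).restrict (Ioo (0:ℝ) T ×ˢ (univ : Set ℝ))),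
    ρ1 z.1 z.2 = ρ2 z.1 z.2

section partA
/-- `r` selects, for each speed `ξ`, a minimizer of `f u - ξ u` on `[a,b]`. -/
def Fan (f : ℝ → ℝ) (a b : ℝ) (r : ℝ → ℝ) : Prop :=
  ∀ ξ, r ξ ∈ Icc a b ∧ ∀ u ∈ Icc a b, f (r ξ) - ξ * r ξ ≤ f u - ξ * u

lemma fan_exists {f : ℝ → ℝ} {a b : ℝ} (hab : a ≤ b) (hf : ContinuousOn f (Icc a b)) :
    ∃ r, Fan f a b r := by
  have : ∀ ξ : ℝ, ∃ v, v ∈ Icc a b ∧ ∀ u ∈ Icc a b, f v - ξ * v ≤ f u - ξ * u := by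
    intro ξ
    have hc : ContinuousOn (fun u => f u - ξ * u) (Icc a b) :=
      hf.sub (continuous_const.mul continuous_id).continuousOn
    obtain ⟨v, hv, hm⟩ := isCompact_Icc.exists_isMinOn (nonempty_Icc.2 hab) hc
    exact ⟨v, hv, fun u hu => hm hu⟩
  choose r hr using this
  exact ⟨r, hr⟩

lemma fan_mono {f : ℝ → ℝ} {a b : ℝ} {r : ℝ → ℝ} (h : Fan f a b r) : Monotone r := by
  intro ξ η hle
  rcases hle.eq_or_lt with rfl | hlt
  · exact le_rfl
  have h1 := (h ξ).2 _ (h η).1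
  have h2 := (h η).2 _ (h ξ).1
  by_contra hc
  push Not at hc
  nlinarith

lemma fan_bd {f : ℝ → ℝ} {a b : ℝ} {r : ℝ → ℝ} (h : Fan f a b r) (ξ η : ℝ) :
    |(f (r η) - η * r η) - (f (r ξ) - ξ * r ξ) - (η - ξ) * (- r ξ)| ≤ |η - ξ| * |r η - r ξ| := by
  have h1 := (h ξ).2 _ (h η).1
  have h2 := (h η).2 _ (h ξ).1
  rw [← abs_mul, abs_of_nonpos (by linarith)]
  refine le_trans ?_ (le_abs_self _)
  linarith

lemma fan_deriv {f : ℝ → ℝ} {a b : ℝ} {r : ℝ → ℝ} (h : Fan f a b r) {ξ : ℝ}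
    (hc : ContinuousAt r ξ) : HasDerivAt (fun ξ => f (r ξ) - ξ * r ξ) (- r ξ) ξ := by
  rw [hasDerivAt_iff_isLittleO, Asymptotics.isLittleO_iff]
  intro c hc0
  have := Metric.tendsto_nhds.1 hc c hc0
  filter_upwards [this] with η hη
  have := fan_bd h ξ η
  rw [Real.dist_eq] at hη
  simp only [smul_eq_mul, Real.norm_eq_abs]
  refine this.trans ?_
  rw [mul_comm]
  exact mul_le_mul_of_nonneg_right hη.le (abs_nonneg _)

lemma fan_cont {f : ℝ → ℝ} {a b : ℝ} {r : ℝ → ℝ} (h : Fan f a b r) :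
    Continuous (fun ξ => f (r ξ) - ξ * r ξ) := by
  rw [continuous_iff_continuousAt]
  intro ξ
  have key : ∀ η, |(f (r η) - η * r η) - (f (r ξ) - ξ * r ξ)| ≤ |η - ξ| * ((b - a) + |r ξ|) := by
    intro η
    have h1 := fan_bd h ξ η
    have h2 : |r η - r ξ| ≤ b - a := by
      rw [abs_le]; constructor <;> linarith [(h ξ).1.1, (h ξ).1.2, (h η).1.1, (h η).1.2]
    have h3 := abs_sub_abs_le_abs_sub ((f (r η) - η * r η) - (f (r ξ) - ξ * r ξ)) ((η - ξ) * (- r ξ))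
    have h4 : |(η - ξ) * (- r ξ)| = |η - ξ| * |r ξ| := by rw [abs_mul, abs_neg]
    have h5 := mul_le_mul_of_nonneg_left h2 (abs_nonneg (η - ξ))
    rw [mul_add]
    linarith
  refine tendsto_iff_norm_sub_tendsto_zero.2 ?_
  refine squeeze_zero (fun _ => norm_nonneg _) (fun η => key η) ?_
  have : Continuous (fun η => |η - ξ| * ((b - a) + |r ξ|)) := by fun_prop
  have := this.tendsto ξ
  simpa using this

lemma fan_ftc {f : ℝ → ℝ} {a b : ℝ} {r : ℝ → ℝ} (h : Fan f a b r) (k : ℝ) {ψ ψ' : ℝ → ℝ}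
    (hψ : ∀ x, HasDerivAt ψ (ψ' x) x) (hc : Continuous ψ') (α β : ℝ) :
    IntervalIntegrable (fun ξ => (f (r ξ) - ξ * r ξ - f k + ξ * k) * ψ' ξ + (k - r ξ) * ψ ξ)
      volume α β ∧
    ∫ ξ in α..β, ((f (r ξ) - ξ * r ξ - f k + ξ * k) * ψ' ξ + (k - r ξ) * ψ ξ) =
      (f (r β) - β * r β - f k + β * k) * ψ β - (f (r α) - α * r α - f k + α * k) * ψ α := by
  have hm := fan_cont h
  have hψc : Continuous ψ := continuous_iff_continuousAt.2 fun x => (hψ x).continuousAt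
  have hInt0 : IntervalIntegrable
      (fun ξ => (f (r ξ) - ξ * r ξ - f k + ξ * k) * ψ' ξ + (k - r ξ) * ψ ξ) volume α β := by
    refine IntervalIntegrable.add (Continuous.intervalIntegrable (by fun_prop) _ _) ?_
    refine IntervalIntegrable.mul_continuousOn ?_ hψc.continuousOn
    exact intervalIntegrable_const.sub (fan_mono h).intervalIntegrable
  refine ⟨hInt0, ?_⟩
  refine integral_eq_of_hasDerivAt_off_countable
    (fun ξ => (f (r ξ) - ξ * r ξ - f k + ξ * k) * ψ ξ) _ (fan_mono h).countable_not_continuousAt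
    (Continuous.continuousOn (by fun_prop)) ?_ hInt0
  intro x hx
  have hx2 : ContinuousAt r x := by
    by_contra hcon; exact hx.2 hcon
  have := ((((fan_deriv h hx2).sub_const (f k)).add ((hasDerivAt_id x).mul_const k)).mul (hψ x))
  refine this.congr_deriv ?_
  simp
  ring

/-- `sign (r-k) (f r - f k) - ξ |r - k|`. -/
def GG (f : ℝ → ℝ) (k v ξ : ℝ) : ℝ := Real.sign (v - k) * (f v - f k) - ξ * |v - k|

lemma GG_ge {f : ℝ → ℝ} {k v ξ : ℝ} (h : k ≤ v) : GG f k v ξ = f v - ξ * v - f k + ξ * k := by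
  unfold GG
  rcases h.eq_or_lt with rfl | h
  · simp
  · rw [Real.sign_of_pos (by linarith), abs_of_pos (by linarith)]; ring

lemma GG_le {f : ℝ → ℝ} {k v ξ : ℝ} (h : v ≤ k) : GG f k v ξ = -(f v - ξ * v - f k + ξ * k) := by
  unfold GG
  rcases h.eq_or_lt with rfl | h
  · simp
  · rw [Real.sign_of_neg (by linarith), abs_of_neg (by linarith)]; ring

lemma GG_neg (f : ℝ → ℝ) (k v ξ : ℝ) : GG (fun u => - f (-u)) (-k) (-v) ξ = GG f k v ξ := by
  unfold GG
  have : -v - -k = -(v - k) := by ring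
  rw [this, Real.sign_neg, abs_neg]
  simp
  ring

lemma piece_up {f : ℝ → ℝ} {a b : ℝ} {r : ℝ → ℝ} (h : Fan f a b r) (k : ℝ) {ψ ψ' : ℝ → ℝ}
    (hψ : ∀ x, HasDerivAt ψ (ψ' x) x) (hc : Continuous ψ') {α β : ℝ} (hab : α ≤ β)
    (hk : ∀ ξ ∈ Ioo α β, k ≤ r ξ) :
    IntervalIntegrable (fun ξ => GG f k (r ξ) ξ * ψ' ξ - |r ξ - k| * ψ ξ) volume α β ∧
    ∫ ξ in α..β, (GG f k (r ξ) ξ * ψ' ξ - |r ξ - k| * ψ ξ) =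
      (f (r β) - β * r β - f k + β * k) * ψ β - (f (r α) - α * r α - f k + α * k) * ψ α := by
  obtain ⟨h1, h2⟩ := fan_ftc h k hψ hc α β
  have hE : EqOn (fun ξ => (f (r ξ) - ξ * r ξ - f k + ξ * k) * ψ' ξ + (k - r ξ) * ψ ξ)
      (fun ξ => GG f k (r ξ) ξ * ψ' ξ - |r ξ - k| * ψ ξ) (Ioo α β) := by
    intro ξ hξ
    have := hk ξ hξ
    simp only
    rw [GG_ge this, abs_of_nonneg (by linarith)]; ring
  have hAE : ∀ᵐ ξ, ξ ∈ uIoc α β → (fun ξ => (f (r ξ) - ξ * r ξ - f k + ξ * k) * ψ' ξ + (k - r ξ) * ψ ξ) ξ =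
      (fun ξ => GG f k (r ξ) ξ * ψ' ξ - |r ξ - k| * ψ ξ) ξ := by
    have : ∀ᵐ ξ : ℝ, ξ ≠ β := by simp [ae_iff]
    filter_upwards [this] with ξ hξ hm
    rw [uIoc_of_le hab] at hm
    exact hE ⟨hm.1, lt_of_le_of_ne hm.2 hξ⟩
  constructor
  · exact h1.congr_ae ((ae_restrict_iff' measurableSet_uIoc).2 hAE)
  · rw [← h2]
    exact (intervalIntegral.integral_congr_ae hAE).symm

lemma piece_down {f : ℝ → ℝ} {a b : ℝ} {r : ℝ → ℝ} (h : Fan f a b r) (k : ℝ) {ψ ψ' : ℝ → ℝ}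
    (hψ : ∀ x, HasDerivAt ψ (ψ' x) x) (hc : Continuous ψ') {α β : ℝ} (hab : α ≤ β)
    (hk : ∀ ξ ∈ Ioo α β, r ξ ≤ k) :
    IntervalIntegrable (fun ξ => GG f k (r ξ) ξ * ψ' ξ - |r ξ - k| * ψ ξ) volume α β ∧
    ∫ ξ in α..β, (GG f k (r ξ) ξ * ψ' ξ - |r ξ - k| * ψ ξ) =
      -((f (r β) - β * r β - f k + β * k) * ψ β - (f (r α) - α * r α - f k + α * k) * ψ α) := by
  obtain ⟨h1, h2⟩ := fan_ftc h k hψ hc α β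
  have hE : EqOn (fun ξ => -((f (r ξ) - ξ * r ξ - f k + ξ * k) * ψ' ξ + (k - r ξ) * ψ ξ))
      (fun ξ => GG f k (r ξ) ξ * ψ' ξ - |r ξ - k| * ψ ξ) (Ioo α β) := by
    intro ξ hξ
    have := hk ξ hξ
    simp only
    rw [GG_le this, abs_of_nonpos (by linarith)]; ring
  have hAE : ∀ᵐ ξ, ξ ∈ uIoc α β → (fun ξ => -((f (r ξ) - ξ * r ξ - f k + ξ * k) * ψ' ξ + (k - r ξ) * ψ ξ)) ξ =
      (fun ξ => GG f k (r ξ) ξ * ψ' ξ - |r ξ - k| * ψ ξ) ξ := by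
    have : ∀ᵐ ξ : ℝ, ξ ≠ β := by simp [ae_iff]
    filter_upwards [this] with ξ hξ hm
    rw [uIoc_of_le hab] at hm
    exact hE ⟨hm.1, lt_of_le_of_ne hm.2 hξ⟩
  constructor
  · exact h1.neg.congr_ae ((ae_restrict_iff' measurableSet_uIoc).2 hAE)
  · rw [← h2, ← intervalIntegral.integral_neg]
    exact (intervalIntegral.integral_congr_ae hAE).symm

/-- Entropy inequality for one fan on an interval of speeds. -/
lemma piece {f : ℝ → ℝ} {a b : ℝ} {r : ℝ → ℝ} (h : Fan f a b r) (k : ℝ) {ψ ψ' : ℝ → ℝ}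
    (hψ : ∀ x, HasDerivAt ψ (ψ' x) x) (hc : Continuous ψ') (hψ0 : ∀ x, 0 ≤ ψ x)
    {α β : ℝ} (hab : α ≤ β) :
    IntervalIntegrable (fun ξ => GG f k (r ξ) ξ * ψ' ξ - |r ξ - k| * ψ ξ) volume α β ∧
    GG f k (r β) β * ψ β - GG f k (r α) α * ψ α ≤
    ∫ ξ in α..β, (GG f k (r ξ) ξ * ψ' ξ - |r ξ - k| * ψ ξ) := by
  have hmono := fan_mono h
  by_cases h1 : r β ≤ k
  · obtain ⟨hi, he⟩ := piece_down h k hψ hc hab (fun ξ hξ => (hmono hξ.2.le).trans h1)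
    refine ⟨hi, ?_⟩
    rw [he, GG_le h1, GG_le ((hmono hab).trans h1)]
    linarith
  by_cases h2 : k ≤ r α
  · obtain ⟨hi, he⟩ := piece_up h k hψ hc hab (fun ξ hξ => h2.trans (hmono hξ.1.le))
    refine ⟨hi, ?_⟩
    rw [he, GG_ge h2, GG_ge (h2.trans (hmono hab))]
  push Not at h1 h2
  have hkS : k ∈ Icc a b := ⟨(h α).1.1.trans h2.le, h1.le.trans (h β).1.2⟩
  set c := sSup {ξ | ξ ≤ β ∧ r ξ ≤ k} with hcdef
  have hbd : BddAbove {ξ | ξ ≤ β ∧ r ξ ≤ k} := ⟨β, fun x hx => hx.1⟩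
  have hα : α ∈ {ξ | ξ ≤ β ∧ r ξ ≤ k} := ⟨hab, h2.le⟩
  have hac : α ≤ c := le_csSup hbd hα
  have hcb : c ≤ β := csSup_le ⟨α, hα⟩ fun x hx => hx.1
  obtain ⟨hi1, he1⟩ := piece_down h k hψ hc hac (fun ξ hξ => by
    obtain ⟨y, hy, hlt⟩ := exists_lt_of_lt_csSup ⟨α, hα⟩ hξ.2
    exact (hmono hlt.le).trans hy.2)
  obtain ⟨hi2, he2⟩ := piece_up h k hψ hc hcb (fun ξ hξ => by
    by_contra hcon
    push Not at hcon
    exact absurd (le_csSup hbd (show ξ ∈ {ξ | ξ ≤ β ∧ r ξ ≤ k} from ⟨hξ.2.le, hcon.le⟩))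
      (not_le.2 hξ.1))
  refine ⟨hi1.trans hi2, ?_⟩
  rw [← intervalIntegral.integral_add_adjacent_intervals hi1 hi2, he1, he2, GG_ge h1.le,
    GG_le h2.le]
  have h3 := (h c).2 k hkS
  have h4 : (f (r c) - c * r c - f k + c * k) * ψ c ≤ 0 :=
    mul_nonpos_of_nonpos_of_nonneg (by linarith) (hψ0 c)
  linarith

/-- A fan, of either orientation. -/
def GFan (f : ℝ → ℝ) (a b : ℝ) (r : ℝ → ℝ) : Prop :=
  Fan f a b r ∨ Fan (fun u => - f (-u)) (-b) (-a) (fun ξ => - r ξ)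

lemma gpiece {f : ℝ → ℝ} {a b : ℝ} {r : ℝ → ℝ} (h : GFan f a b r) (k : ℝ) {ψ ψ' : ℝ → ℝ}
    (hψ : ∀ x, HasDerivAt ψ (ψ' x) x) (hc : Continuous ψ') (hψ0 : ∀ x, 0 ≤ ψ x)
    {α β : ℝ} (hab : α ≤ β) :
    IntervalIntegrable (fun ξ => GG f k (r ξ) ξ * ψ' ξ - |r ξ - k| * ψ ξ) volume α β ∧
    GG f k (r β) β * ψ β - GG f k (r α) α * ψ α ≤
    ∫ ξ in α..β, (GG f k (r ξ) ξ * ψ' ξ - |r ξ - k| * ψ ξ) := by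
  rcases h with h | h
  · exact piece h k hψ hc hψ0 hab
  · have := piece h (-k) hψ hc hψ0 hab
    have e : ∀ v : ℝ, |-v - -k| = |v - k| := fun v => by
      rw [show -v - -k = -(v - k) by ring, abs_neg]
    simpa only [GG_neg, e] using this

lemma gfan_mem {f : ℝ → ℝ} {a b : ℝ} {r : ℝ → ℝ} (h : GFan f a b r) (ξ : ℝ) : r ξ ∈ Icc a b := by
  rcases h with h | h
  · exact (h ξ).1
  · have := (h ξ).1
    constructor <;> linarith [this.1, this.2]

lemma gfan_mono {f : ℝ → ℝ} {a b : ℝ} {r : ℝ → ℝ} (h : GFan f a b r) :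
    Monotone r ∨ Antitone r := by
  rcases h with h | h
  · exact Or.inl (fan_mono h)
  · exact Or.inr (fun x y hxy => by have := fan_mono h hxy; simp at this; exact this)

lemma gfan_meas {f : ℝ → ℝ} {a b : ℝ} {r : ℝ → ℝ} (h : GFan f a b r) : Measurable r := by
  rcases gfan_mono h with h | h
  · exact h.measurable
  · exact h.measurable

lemma gfan_countable {f : ℝ → ℝ} {a b : ℝ} {r : ℝ → ℝ} (h : GFan f a b r) :
    {x | ¬ ContinuousAt r x}.Countable := by
  rcases gfan_mono h with h | h
  · exact h.countable_not_continuousAt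
  · exact h.countable_not_continuousAt

lemma fan_flux {f : ℝ → ℝ} {a b : ℝ} {r : ℝ → ℝ} (h : Fan f a b r)
    (hf : ContinuousOn f (Icc a b)) {F : Filter ℝ} [F.NeBot] (hF : F ≤ nhds 0) {l : ℝ}
    (hl : Tendsto r F (nhds l)) : f l = f (r 0) := by
  have hlm : l ∈ Icc a b := isClosed_Icc.mem_of_tendsto hl (Eventually.of_forall fun ξ => (h ξ).1)
  have h1 : Tendsto (fun ξ => f (r ξ) - ξ * r ξ) F (nhds (f l - 0 * l)) := by
    have : Tendsto (fun ξ => f (r ξ)) F (nhds (f l)) := by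
      refine (hf l hlm).tendsto.comp ?_
      exact tendsto_nhdsWithin_iff.2 ⟨hl, Eventually.of_forall fun ξ => (h ξ).1⟩
    exact this.sub (Tendsto.mul hF hl)
  have h2 := ((fan_cont h).tendsto 0).mono_left hF
  have := tendsto_nhds_unique h1 h2
  simpa using this

lemma gfan_flux {f : ℝ → ℝ} {a b : ℝ} {r : ℝ → ℝ} (h : GFan f a b r)
    (hf : ContinuousOn f (Icc a b)) {F : Filter ℝ} [F.NeBot] (hF : F ≤ nhds 0) {l : ℝ}
    (hl : Tendsto r F (nhds l)) : f l = f (r 0) := by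
  rcases h with h | h
  · exact fan_flux h hf hF hl
  · have := fan_flux h (hf.neg.comp continuous_neg.continuousOn (fun x hx => by
      constructor <;> linarith [hx.1, hx.2])) hF hl.neg
    simpa using this

lemma gfan_left {f : ℝ → ℝ} {a b : ℝ} {r : ℝ → ℝ} (h : GFan f a b r)
    (hf : ContinuousOn f (Icc a b)) :
    ∃ l, Tendsto r (nhdsWithin 0 (Iio 0)) (nhds l) ∧ f l = f (r 0) := by
  have : ∃ l, Tendsto r (nhdsWithin 0 (Iio 0)) (nhds l) := by
    rcases gfan_mono h with h | h
    · exact ⟨_, h.tendsto_nhdsLT 0⟩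
    · exact ⟨_, h.tendsto_nhdsLT 0⟩
  obtain ⟨l, hl⟩ := this
  exact ⟨l, hl, gfan_flux h hf nhdsWithin_le_nhds hl⟩

lemma gfan_right {f : ℝ → ℝ} {a b : ℝ} {r : ℝ → ℝ} (h : GFan f a b r)
    (hf : ContinuousOn f (Icc a b)) :
    ∃ l, Tendsto r (nhdsWithin 0 (Ioi 0)) (nhds l) ∧ f l = f (r 0) := by
  have : ∃ l, Tendsto r (nhdsWithin 0 (Ioi 0)) (nhds l) := by
    rcases gfan_mono h with h | h
    · exact ⟨_, h.tendsto_nhdsGT 0⟩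
    · exact ⟨_, h.tendsto_nhdsGT 0⟩
  obtain ⟨l, hl⟩ := this
  exact ⟨l, hl, gfan_flux h hf nhdsWithin_le_nhds hl⟩

end partA

section partB
lemma fan_far_left {f : ℝ → ℝ} {a b : ℝ} {r : ℝ → ℝ} (h : Fan f a b r) (hab : a ≤ b) {L : NNReal}
    (hL : LipschitzOnWith L f (Icc a b)) {ξ : ℝ} (hξ : ξ < -L) : r ξ = a := by
  by_contra hne
  have h1 := (h ξ).1
  have hlt : a < r ξ := lt_of_le_of_ne h1.1 (Ne.symm hne)
  have h2 := (h ξ).2 a ⟨le_rfl, hab⟩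
  have h3 := hL.dist_le_mul a ⟨le_rfl, hab⟩ (r ξ) h1
  rw [Real.dist_eq, Real.dist_eq, abs_of_nonpos (by linarith : a - r ξ ≤ 0)] at h3
  have h4 := le_abs_self (f a - f (r ξ))
  nlinarith

lemma fan_far_right {f : ℝ → ℝ} {a b : ℝ} {r : ℝ → ℝ} (h : Fan f a b r) (hab : a ≤ b) {L : NNReal}
    (hL : LipschitzOnWith L f (Icc a b)) {ξ : ℝ} (hξ : (L : ℝ) < ξ) : r ξ = b := by
  by_contra hne
  have h1 := (h ξ).1
  have hlt : r ξ < b := lt_of_le_of_ne h1.2 hne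
  have h2 := (h ξ).2 b ⟨hab, le_rfl⟩
  have h3 := hL.dist_le_mul b ⟨hab, le_rfl⟩ (r ξ) h1
  rw [Real.dist_eq, Real.dist_eq, abs_of_nonneg (by linarith : 0 ≤ b - r ξ)] at h3
  have h4 := le_abs_self (f b - f (r ξ))
  nlinarith

/-- Gluing two fans at `ξ = 0` satisfies the one-dimensional entropy inequality. -/
lemma oneD {R fmax : ℝ} {f : ℝ → ℝ} {a b a' b' : ℝ} {r1 r2 : ℝ → ℝ}
    (h1 : GFan f a b r1) (h2 : GFan f a' b' r2)
    {pbar : ℝ} (hp0 : 0 ≤ pbar) (hf1 : f (r1 0) = pbar) (hf2 : f (r2 0) = pbar) (hle : r2 0 ≤ r1 0)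
    (hmax : ∀ k ∈ Icc (0:ℝ) R, f k ≤ fmax) (hnn : ∀ k ∈ Icc (0:ℝ) R, 0 ≤ f k) (hpm : pbar ≤ fmax)
    (hfm : 0 < fmax)
    {k : ℝ} (hk : k ∈ Icc (0:ℝ) R) {ψ ψ' : ℝ → ℝ}
    (hψ : ∀ x, HasDerivAt ψ (ψ' x) x) (hc : Continuous ψ') (hψ0 : ∀ x, 0 ≤ ψ x)
    {M : ℝ} (hM : 0 < M) (hz : ∀ x, M ≤ |x| → ψ x = 0) (hz' : ∀ x, M ≤ |x| → ψ' x = 0) :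
    0 ≤ (∫ ξ, (GG f k (if ξ < 0 then r1 ξ else r2 ξ) ξ * ψ' ξ -
      |(if ξ < 0 then r1 ξ else r2 ξ) - k| * ψ ξ)) + 2 * ((1 - pbar / fmax) * f k * ψ 0) := by
  obtain ⟨hi1, he1⟩ := gpiece h1 k hψ hc hψ0 (show -M ≤ 0 by linarith)
  obtain ⟨hi2, he2⟩ := gpiece h2 k hψ hc hψ0 hM.le
  set g := fun ξ => (GG f k (if ξ < 0 then r1 ξ else r2 ξ) ξ * ψ' ξ -
      |(if ξ < 0 then r1 ξ else r2 ξ) - k| * ψ ξ) with hg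
  have hA1 : ∀ᵐ ξ, ξ ∈ uIoc (-M) 0 → GG f k (r1 ξ) ξ * ψ' ξ - |r1 ξ - k| * ψ ξ = g ξ := by
    have : ∀ᵐ ξ : ℝ, ξ ≠ 0 := by simp [ae_iff]
    filter_upwards [this] with ξ hξ hm
    rw [uIoc_of_le (by linarith)] at hm
    have : ξ < 0 := lt_of_le_of_ne hm.2 hξ
    simp [hg, this]
  have hA2 : ∀ᵐ ξ, ξ ∈ uIoc 0 M → GG f k (r2 ξ) ξ * ψ' ξ - |r2 ξ - k| * ψ ξ = g ξ := by
    refine Eventually.of_forall fun ξ hm => ?_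
    rw [uIoc_of_le (by linarith)] at hm
    have : ¬ ξ < 0 := not_lt.2 hm.1.le
    simp [hg, this]
  have hj1 : IntervalIntegrable g volume (-M) 0 :=
    hi1.congr_ae ((ae_restrict_iff' measurableSet_uIoc).2 hA1)
  have hj2 : IntervalIntegrable g volume 0 M :=
    hi2.congr_ae ((ae_restrict_iff' measurableSet_uIoc).2 hA2)
  have hsupp : Function.support g ⊆ Ioc (-M) M := by
    intro x hx
    by_contra hcon
    apply hx
    have : M ≤ |x| := by
      by_contra hlt
      push Not at hlt
      rw [abs_lt] at hlt
      exact hcon ⟨hlt.1, hlt.2.le⟩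
    simp [hg, hz x this, hz' x this]
  rw [← intervalIntegral.integral_eq_integral_of_support_subset hsupp,
    ← intervalIntegral.integral_add_adjacent_intervals hj1 hj2,
    ← intervalIntegral.integral_congr_ae hA1, ← intervalIntegral.integral_congr_ae hA2]
  have z1 : ψ (-M) = 0 := hz _ (by rw [abs_neg]; exact le_abs_self M)
  have z2 : ψ M = 0 := hz _ (le_abs_self M)
  rw [z1] at he1
  rw [z2] at he2
  have hfk := hnn k hk
  have hfk2 := hmax k hk
  have hq : 0 ≤ 1 - pbar / fmax := by
    rw [sub_nonneg, div_le_one hfm]; exact hpm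
  have hq2 : pbar / fmax * f k ≤ pbar := by
    rw [div_mul_eq_mul_div, div_le_iff₀ hfm]; exact mul_le_mul_of_nonneg_left hfk2 hp0
  have key : 0 ≤ GG f k (r1 0) 0 - GG f k (r2 0) 0 + 2 * ((1 - pbar / fmax) * f k) := by
    have hn : 0 ≤ (1 - pbar / fmax) * f k := mul_nonneg hq hfk
    rcases le_total k (r2 0) with hk2 | hk2
    · rw [GG_ge hk2, GG_ge (hk2.trans hle), hf1, hf2]
      linarith
    · rcases le_total k (r1 0) with hk1 | hk1
      · rw [GG_ge hk1, GG_le hk2, hf1, hf2]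
        linarith
      · rw [GG_le hk1, GG_le hk2, hf1, hf2]
        linarith
  have := mul_nonneg key (hψ0 0)
  linarith

/-- Self-similar function with profile `r`. -/
def sol (r : ℝ → ℝ) (ρL ρR : ℝ) (t x : ℝ) : ℝ := if t ≤ 0 then riem ρL ρR x else r (x / t)

/-- The facts on a self-similar profile used below. -/
structure Prof (R fmax : ℝ) (f r : ℝ → ℝ) (ρL ρR pbar lm lp V : ℝ) : Prop where
  hR : 0 < R
  hL : ρL ∈ Icc 0 R
  hRR : ρR ∈ Icc 0 R
  fc : ContinuousOn f (Icc 0 R)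
  meas : Measurable r
  mem : ∀ ξ, r ξ ∈ Icc 0 R
  cnt : {x | ¬ ContinuousAt r x}.Countable
  V0 : 0 < V
  far_l : ∀ ξ, ξ < -V → r ξ = ρL
  far_r : ∀ ξ, V < ξ → r ξ = ρR
  tl : Tendsto r (nhdsWithin 0 (Iio 0)) (nhds lm)
  tr : Tendsto r (nhdsWithin 0 (Ioi 0)) (nhds lp)
  fl : f lm = pbar
  fr : f lp = pbar
  lmm : lm ∈ Icc 0 R
  lpm : lp ∈ Icc 0 R
  ent : ∀ k ∈ Icc (0:ℝ) R, ∀ ψ ψ' : ℝ → ℝ, (∀ x, HasDerivAt ψ (ψ' x) x) → Continuous ψ' →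
    (∀ x, 0 ≤ ψ x) → ∀ M : ℝ, 0 < M → (∀ x, M ≤ |x| → ψ x = 0) → (∀ x, M ≤ |x| → ψ' x = 0) →
    0 ≤ (∫ ξ, (GG f k (r ξ) ξ * ψ' ξ - |r ξ - k| * ψ ξ)) + 2 * ((1 - pbar / fmax) * f k * ψ 0)

variable {R fmax : ℝ} {f r : ℝ → ℝ} {ρL ρR pbar lm lp V : ℝ}

lemma sol_mem (h : Prof R fmax f r ρL ρR pbar lm lp V) (t x : ℝ) : sol r ρL ρR t x ∈ Icc 0 R := by
  unfold sol riem
  split_ifs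
  · exact h.hL
  · exact h.hRR
  · exact h.mem _

lemma sol_meas (h : Prof R fmax f r ρL ρR pbar lm lp V) :
    Measurable (Function.uncurry (sol r ρL ρR)) := by
  unfold sol riem Function.uncurry
  refine Measurable.ite (measurableSet_le measurable_fst measurable_const) ?_ ?_
  · exact Measurable.ite (measurableSet_lt measurable_snd measurable_const) measurable_const
      measurable_const
  · exact h.meas.comp (measurable_snd.div measurable_fst)

lemma sol_near0 (h : Prof R fmax f r ρL ρR pbar lm lp V) {x : ℝ} (hx : x ≠ 0) :
    ∀ᶠ t in nhdsWithin (0:ℝ) (Ici 0), sol r ρL ρR t x = riem ρL ρR x := by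
  have hV := h.V0
  have hpos : 0 < |x| / V := div_pos (abs_pos.2 hx) hV
  have h1 : ∀ᶠ t in nhdsWithin (0:ℝ) (Ici 0), t < |x| / V :=
    nhdsWithin_le_nhds (Iio_mem_nhds hpos)
  filter_upwards [h1, self_mem_nhdsWithin] with t ht ht0
  unfold sol
  split_ifs with h0
  · rfl
  push Not at h0
  rw [lt_div_iff₀ hV] at ht
  unfold riem
  split_ifs with hneg
  · apply h.far_l
    rw [div_lt_iff₀ h0]
    rw [abs_of_neg hneg] at ht
    linarith
  · push Not at hneg
    apply h.far_r
    rw [lt_div_iff₀ h0]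
    rw [abs_of_nonneg hneg] at ht
    linarith

lemma sol_cont (h : Prof R fmax f r ρL ρR pbar lm lp V) {s : ℝ} (hs : 0 ≤ s) :
    ∀ᵐ x : ℝ, Tendsto (fun t => sol r ρL ρR t x) (nhdsWithin s (Ici 0)) (nhds (sol r ρL ρR s x)) := by
  rcases hs.eq_or_lt with rfl | hs
  · have : ∀ᵐ ξ : ℝ, ξ ≠ 0 := by simp [ae_iff]
    filter_upwards [this] with x hx
    have e : sol r ρL ρR 0 x = riem ρL ρR x := by simp [sol]
    rw [e]
    exact tendsto_const_nhds.congr' ((sol_near0 h hx).mono fun t ht => ht.symm)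
  · have hc : ((fun x : ℝ => x * s) '' {x | ¬ ContinuousAt r x}).Countable := h.cnt.image _
    have : ∀ᵐ x : ℝ, x ∉ ((fun x : ℝ => x * s) '' {x | ¬ ContinuousAt r x}) := hc.ae_notMem _
    filter_upwards [this] with x hx
    have hcx : ContinuousAt r (x / s) := by
      by_contra hcon
      exact hx ⟨x / s, hcon, by field_simp⟩
    have e : sol r ρL ρR s x = r (x / s) := by simp [sol, hs]
    rw [e]
    have h2 : Tendsto (fun t : ℝ => r (x / t)) (nhds s) (nhds (r (x / s))) :=
      hcx.tendsto.comp (tendsto_const_nhds.div tendsto_id hs.ne')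
    refine (h2.mono_left nhdsWithin_le_nhds).congr' ?_
    have : ∀ᶠ t in nhdsWithin s (Ici 0), 0 < t := nhdsWithin_le_nhds (Ioi_mem_nhds hs)
    filter_upwards [this] with t ht
    simp [sol, ht]

lemma sol_reg (h : Prof R fmax f r ρL ρR pbar lm lp V) : RegSol R (sol r ρL ρR) := by
  refine ⟨sol_meas h, sol_mem h, fun r' hr' s hs => ?_⟩
  have hm : ∀ t, Measurable (sol r ρL ρR t) := fun t => (sol_meas h).comp measurable_prodMk_left
  have := tendsto_integral_filter_of_dominated_convergence (μ := volume.restrict (Icc (-r') r'))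
    (l := nhdsWithin s (Ici 0)) (F := fun t x => |sol r ρL ρR t x - sol r ρL ρR s x|)
    (f := fun _ => 0) (fun _ => R) (Eventually.of_forall fun t =>
      (((hm t).sub (hm s)).abs).aestronglyMeasurable)
    (Eventually.of_forall fun t => Eventually.of_forall fun x => by
      have h1 := sol_mem h t x
      have h2 := sol_mem h s x
      rw [Real.norm_eq_abs, abs_abs, abs_le]
      constructor <;> linarith [h1.1, h1.2, h2.1, h2.2])
    (by simp)
    (by
      refine ae_restrict_of_ae ?_
      filter_upwards [sol_cont h hs] with x hx
      have := (hx.sub_const (sol r ρL ρR s x)).abs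
      simpa using this)
  simpa using this

lemma test_bounds {φ : ℝ × ℝ → ℝ} (hφ : TestFn φ) : ∃ M > (0:ℝ), ∃ C ≥ (0:ℝ),
    (∀ t x, M ≤ |t| ∨ M ≤ |x| → φ (t, x) = 0 ∧ pdT φ (t, x) = 0 ∧ pdX φ (t, x) = 0) ∧
    (∀ z, |φ z| ≤ C ∧ |pdT φ z| ≤ C ∧ |pdX φ z| ≤ C) ∧ Continuous φ ∧ Continuous (pdT φ) ∧
    Continuous (pdX φ) ∧ ∀ z, HasFDerivAt φ (fderiv ℝ φ z) z := by
  obtain ⟨hs, hc⟩ := hφ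
  have hd : ∀ z, HasFDerivAt φ (fderiv ℝ φ z) z := fun z =>
    (hs.differentiable (by simp) z).hasFDerivAt
  have hcf : Continuous (fderiv ℝ φ) := hs.continuous_fderiv (by simp)
  have hcT : Continuous (pdT φ) := hcf.clm_apply continuous_const
  have hcX : Continuous (pdX φ) := hcf.clm_apply continuous_const
  have hcs : HasCompactSupport (fderiv ℝ φ) := hc.fderiv ℝ
  have hsT : HasCompactSupport (pdT φ) := hcs.comp_left (g := fun L : ℝ × ℝ →L[ℝ] ℝ => L (1, 0)) rfl
  have hsX : HasCompactSupport (pdX φ) := hcs.comp_left (g := fun L : ℝ × ℝ →L[ℝ] ℝ => L (0, 1)) rfl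
  obtain ⟨C1, hC1⟩ := hc.exists_bound_of_continuous hs.continuous
  obtain ⟨C2, hC2⟩ := hsT.exists_bound_of_continuous hcT
  obtain ⟨C3, hC3⟩ := hsX.exists_bound_of_continuous hcX
  obtain ⟨M, hM⟩ := hc.isCompact.isBounded.subset_closedBall (0 : ℝ × ℝ)
  refine ⟨max M 0 + 1, by positivity, max C1 (max C2 C3), ?_, ?_, ?_, hs.continuous, hcT, hcX, hd⟩
  · exact (norm_nonneg _).trans ((hC1 0).trans (le_max_left _ _))
  · intro t x htx
    have hn : (t, x) ∉ tsupport φ := by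
      intro hmem
      have := hM hmem
      rw [mem_closedBall_zero_iff, Prod.norm_def, max_le_iff] at this
      simp only [Real.norm_eq_abs] at this
      have := le_max_left M 0
      rcases htx with h | h <;> linarith
    have hf0 : fderiv ℝ φ (t, x) = 0 := by
      by_contra hcon
      exact hn (support_fderiv_subset ℝ (by simpa using hcon))
    exact ⟨image_eq_zero_of_notMem_tsupport hn, by simp [pdT, hf0], by simp [pdX, hf0]⟩
  · intro z
    exact ⟨(hC1 z).trans (le_max_left _ _), (hC2 z).trans ((le_max_left _ _).trans (le_max_right _ _)),
      (hC3 z).trans ((le_max_right _ _).trans (le_max_right _ _))⟩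

lemma integrable_of_bdd {g : ℝ → ℝ} (hg : Measurable g) (M C : ℝ) (hz : ∀ x, M < |x| → g x = 0)
    (hb : ∀ x, |x| ≤ M → |g x| ≤ C) : Integrable g := by
  have hi : Integrable ((Icc (-M) M).indicator (fun _ => C)) := by
    rw [integrable_indicator_iff measurableSet_Icc]
    simp
  refine hi.mono' hg.aestronglyMeasurable (Eventually.of_forall fun x => ?_)
  by_cases hx : |x| ≤ M
  · rw [indicator_of_mem (show x ∈ Icc (-M) M from abs_le.1 hx)]
    exact hb x hx
  · rw [indicator_of_notMem (show x ∉ Icc (-M) M from fun hm => hx (abs_le.2 hm)), hz x (not_le.1 hx)]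
    simp

lemma trace_aux (h : Prof R fmax f r ρL ρR pbar lm lp V) {l : ℝ} (hl : l ∈ Icc 0 R)
    (J : ℝ → Set ℝ) (hJm : ∀ ε, MeasurableSet (J ε)) (hJv : ∀ ε > 0, volume.real (J ε) = ε)
    (hJf : ∀ ε, volume (J ε) < ⊤)
    (hJ : ∀ t > (0:ℝ), ∀ η > (0:ℝ), ∀ᶠ ε in nhdsWithin (0:ℝ) (Ioi 0), ∀ x ∈ J ε,
      |sol r ρL ρR t x - l| ≤ η) (φ : ℝ × ℝ → ℝ) (hφ : TestFn φ) :
    Tendsto (fun ε : ℝ => (1 / ε) * ∫ t in Ioi (0:ℝ), ∫ x in J ε,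
        |sol r ρL ρR t x - l| * φ (t, x)) (nhdsWithin 0 (Ioi 0)) (nhds 0) := by
  obtain ⟨M, hM, C, hC, hz, hb, hc, -⟩ := test_bounds hφ
  have hme : Measurable (fun z : ℝ × ℝ => |sol r ρL ρR z.1 z.2 - l| * φ z) :=
    (((sol_meas h).sub_const l).abs).mul hc.measurable
  have habs : ∀ t x, |sol r ρL ρR t x - l| ≤ R := fun t x => by
    have h1 := sol_mem h t x
    rw [abs_le]; constructor <;> linarith [h1.1, h1.2, hl.1, hl.2]
  have hR := h.hR
  have key : ∀ t, ∀ η ≥ (0:ℝ), ∀ ε > (0:ℝ), (∀ x ∈ J ε, |sol r ρL ρR t x - l| ≤ η) →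
      ‖(1 / ε) * ∫ x in J ε, |sol r ρL ρR t x - l| * φ (t, x)‖ ≤ η * C := by
    intro t η hη ε hε hx
    have h1 : ‖∫ x in J ε, |sol r ρL ρR t x - l| * φ (t, x)‖ ≤ (η * C) * volume.real (J ε) := by
      refine norm_setIntegral_le_of_norm_le_const (hJf ε) fun x hxJ => ?_
      rw [norm_mul, Real.norm_eq_abs, abs_abs, Real.norm_eq_abs]
      exact mul_le_mul (hx x hxJ) (hb _).1 (abs_nonneg _) hη
    rw [hJv ε hε] at h1
    rw [norm_mul, Real.norm_eq_abs (1 / ε), abs_of_pos (by positivity)]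
    calc 1 / ε * _ ≤ 1 / ε * (η * C * ε) := mul_le_mul_of_nonneg_left h1 (by positivity)
      _ = η * C := by field_simp
  have := tendsto_integral_filter_of_dominated_convergence (μ := volume.restrict (Ioi (0:ℝ)))
    (l := nhdsWithin (0:ℝ) (Ioi 0))
    (F := fun ε t => (1 / ε) * ∫ x in J ε, |sol r ρL ρR t x - l| * φ (t, x))
    (f := fun _ => 0) ((Icc (-M) M).indicator (fun _ => R * C)) ?_ ?_ ?_ ?_
  · simpa only [integral_const_mul, integral_zero] using this
  · refine Eventually.of_forall fun ε => ?_
    refine AEStronglyMeasurable.const_mul ?_ _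
    exact (StronglyMeasurable.integral_prod_right (f := fun t x => |sol r ρL ρR t x - l| * φ (t, x))
      (ν := volume.restrict (J ε))
      hme.stronglyMeasurable).aestronglyMeasurable
  · filter_upwards [self_mem_nhdsWithin] with ε hε
    refine Eventually.of_forall fun t => ?_
    by_cases ht : |t| ≤ M
    · rw [indicator_of_mem (show t ∈ Icc (-M) M from abs_le.1 ht)]
      exact key t R hR.le ε hε fun x _ => habs t x
    · rw [indicator_of_notMem (show t ∉ Icc (-M) M from fun hm => ht (abs_le.2 hm))]
      have : ∀ x, φ (t, x) = 0 := fun x => (hz t x (Or.inl (not_le.1 ht).le)).1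
      simp [this]
  · refine Integrable.restrict ?_
    rw [integrable_indicator_iff measurableSet_Icc]
    exact integrableOn_const (by simp)
  · filter_upwards [ae_restrict_mem measurableSet_Ioi] with t ht
    rw [Metric.tendsto_nhds]
    intro η hη
    have hη' : 0 < η / (C + 1) := by positivity
    filter_upwards [hJ t ht _ hη', self_mem_nhdsWithin] with ε h1 hε
    rw [dist_zero_right]
    refine (key t _ hη'.le ε hε h1).trans_lt ?_
    rw [div_mul_eq_mul_div, div_lt_iff₀ (by positivity)]
    nlinarith

lemma sol_left (h : Prof R fmax f r ρL ρR pbar lm lp V) :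
    LeftTraceAt (sol r ρL ρR) (fun _ => lm) := by
  intro φ hφ
  refine trace_aux h h.lmm (fun ε => Ioo (-ε) 0) (fun _ => measurableSet_Ioo)
    (fun ε hε => by simp [Real.volume_real_Ioo_of_le (by linarith : -ε ≤ 0)]) (fun ε => by simp) ?_ φ hφ
  intro t ht η hη
  have h1 := h.tl (Metric.closedBall_mem_nhds lm hη)
  rw [mem_map, mem_nhdsLT_iff_exists_Ioo_subset' (show (-1:ℝ) < 0 by norm_num)] at h1
  obtain ⟨d, hd, hsub⟩ := h1
  have hd : d < 0 := hd
  have : ∀ᶠ ε in nhdsWithin (0:ℝ) (Ioi 0), ε < -d * t :=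
    nhdsWithin_le_nhds (Iio_mem_nhds (by nlinarith))
  filter_upwards [this] with ε hε x hx
  have hm : x / t ∈ Ioo d 0 := by
    constructor
    · rw [lt_div_iff₀ ht]; linarith [hx.1]
    · exact div_neg_of_neg_of_pos hx.2 ht
  have := hsub hm
  simp only [mem_preimage, Metric.mem_closedBall, Real.dist_eq] at this
  simpa [sol, not_le.2 ht] using this

lemma sol_right (h : Prof R fmax f r ρL ρR pbar lm lp V) :
    RightTraceAt (sol r ρL ρR) (fun _ => lp) := by
  intro φ hφ
  refine trace_aux h h.lpm (fun ε => Ioo 0 ε) (fun _ => measurableSet_Ioo)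
    (fun ε hε => by simp [Real.volume_real_Ioo_of_le hε.le]) (fun ε => by simp) ?_ φ hφ
  intro t ht η hη
  have h1 := h.tr (Metric.closedBall_mem_nhds lp hη)
  rw [mem_map, mem_nhdsGT_iff_exists_Ioo_subset' (show (0:ℝ) < 1 by norm_num)] at h1
  obtain ⟨d, hd, hsub⟩ := h1
  have hd : 0 < d := hd
  have : ∀ᶠ ε in nhdsWithin (0:ℝ) (Ioi 0), ε < d * t :=
    nhdsWithin_le_nhds (Iio_mem_nhds (by positivity))
  filter_upwards [this] with ε hε x hx
  have hm : x / t ∈ Ioo 0 d := by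
    constructor
    · exact div_pos hx.1 ht
    · rw [div_lt_iff₀ ht]; linarith [hx.2]
  have := hsub hm
  simp only [mem_preimage, Metric.mem_closedBall, Real.dist_eq] at this
  simpa [sol, not_le.2 ht] using this

end partB

section partC
lemma f_comp_meas {α : Type*} [MeasurableSpace α] {f : ℝ → ℝ} {R : ℝ}
    (fc : ContinuousOn f (Icc 0 R)) {g : α → ℝ} (hg : Measurable g) (hm : ∀ a, g a ∈ Icc 0 R) :
    Measurable (fun a => f (g a)) := by
  have h1 : Continuous ((Icc 0 R).restrict f) := fc.restrict
  exact h1.measurable.comp (hg.subtype_mk (h := hm))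

lemma sign_meas : Measurable Real.sign := by
  unfold Real.sign
  exact Measurable.ite measurableSet_Iio measurable_const
    (Measurable.ite measurableSet_Ioi measurable_const measurable_const)

lemma sign_abs_le (x : ℝ) : |Real.sign x| ≤ 1 := by
  rcases Real.sign_apply_eq x with h | h | h <;> rw [h] <;> norm_num

lemma deriv_t {φ : ℝ × ℝ → ℝ} (hd : ∀ z, HasFDerivAt φ (fderiv ℝ φ z) z) (t ξ : ℝ) :
    HasDerivAt (fun t => φ (t, t * ξ)) (pdT φ (t, t * ξ) + ξ * pdX φ (t, t * ξ)) t := by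
  have h1 : HasDerivAt (fun t : ℝ => (t, t * ξ)) ((1 : ℝ), 1 * ξ) t :=
    (hasDerivAt_id t).prodMk ((hasDerivAt_id t).mul_const ξ)
  have h2 := (hd (t, t * ξ)).comp_hasDerivAt t h1
  refine h2.congr_deriv ?_
  have : ((1 : ℝ), 1 * ξ) = ((1 : ℝ), (0:ℝ)) + ξ • ((0:ℝ), (1:ℝ)) := by simp
  rw [this, map_add, map_smul]
  rfl

lemma deriv_xi {φ : ℝ × ℝ → ℝ} (hd : ∀ z, HasFDerivAt φ (fderiv ℝ φ z) z) (t ξ : ℝ) :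
    HasDerivAt (fun ξ => φ (t, t * ξ)) (t * pdX φ (t, t * ξ)) ξ := by
  have h1 : HasDerivAt (fun ξ : ℝ => (t, t * ξ)) ((0 : ℝ), t * 1) ξ :=
    (hasDerivAt_const ξ t).prodMk ((hasDerivAt_id ξ).const_mul t)
  have h2 := (hd (t, t * ξ)).comp_hasDerivAt ξ h1
  refine h2.congr_deriv ?_
  have : ((0 : ℝ), t * 1) = t • ((0:ℝ), (1:ℝ)) := by simp
  rw [this, map_smul]
  rfl

variable {R fmax : ℝ} {f r : ℝ → ℝ} {ρL ρR pbar lm lp V : ℝ}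

lemma scale_int (g : ℝ → ℝ → ℝ) {t : ℝ} (ht : 0 < t) (r : ℝ → ℝ) (ρL ρR : ℝ) :
    ∫ x, g (sol r ρL ρR t x) x = t * ∫ ξ, g (r ξ) (t * ξ) := by
  have := Measure.integral_comp_mul_left (fun x => g (sol r ρL ρR t x) x) t
  have e : ∀ ξ, sol r ρL ρR t (t * ξ) = r ξ := fun ξ => by
    simp [sol, not_le.2 ht, mul_div_cancel_left₀ _ ht.ne']
  simp only [e] at this
  rw [this, abs_of_pos (inv_pos.2 ht), smul_eq_mul, ← mul_assoc, mul_inv_cancel₀ ht.ne', one_mul]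

lemma sol_ent (h : Prof R fmax f r ρL ρR pbar lm lp V) :
    EntIneq R fmax f (fun _ => pbar) (riem ρL ρR) (sol r ρL ρR) := by
  intro φ hφ hφ0 k hk
  obtain ⟨M, hM, C, hC, hz, hb, hc, hcT, hcX, hd⟩ := test_bounds hφ
  have hR := h.hR
  have habs : ∀ v ∈ Icc (0:ℝ) R, |v - k| ≤ R := fun v hv => by
    rw [abs_le]; constructor <;> linarith [hv.1, hv.2, hk.1, hk.2]
  obtain ⟨F, hF⟩ := isCompact_Icc.exists_bound_of_continuousOn h.fc
  have hF0 : 0 ≤ F := (norm_nonneg _).trans (hF k hk)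
  have hQ : ∀ v ∈ Icc (0:ℝ) R, |Real.sign (v - k) * (f v - f k)| ≤ 2 * F := fun v hv => by
    rw [abs_mul]
    have h1 := hF v hv
    have h2 := hF k hk
    rw [Real.norm_eq_abs] at h1 h2
    have h3 : |f v - f k| ≤ 2 * F := (abs_sub _ _).trans (by linarith)
    calc _ ≤ 1 * |f v - f k| := mul_le_mul_of_nonneg_right (sign_abs_le _) (abs_nonneg _)
      _ ≤ _ := by linarith
  have hQm : ∀ {α : Type} [MeasurableSpace α] {g : α → ℝ}, Measurable g → (∀ a, g a ∈ Icc 0 R) →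
      Measurable (fun a => Real.sign (g a - k) * (f (g a) - f k)) := by
    intro α _ g hg hm
    exact (sign_meas.comp (hg.sub_const k)).mul ((f_comp_meas h.fc hg hm).sub_const _)
  have hEm : Measurable (fun ξ => |r ξ - k|) := (h.meas.sub_const k).abs
  have hrQm := hQm h.meas h.mem
  -- notation
  set I : ℝ → ℝ := fun t => ∫ x, (|sol r ρL ρR t x - k| * pdT φ (t, x) +
            Real.sign (sol r ρL ρR t x - k) * (f (sol r ρL ρR t x) - f k) * pdX φ (t, x)) with hI
  set A : ℝ → ℝ := fun t => ∫ x, |sol r ρL ρR t x - k| * φ (t, x) with hA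
  set A' : ℝ → ℝ := fun t => (∫ ξ, |r ξ - k| * φ (t, t * ξ)) +
    t * ∫ ξ, |r ξ - k| * (pdT φ (t, t * ξ) + ξ * pdX φ (t, t * ξ)) with hA'
  have hcomp : ∀ (t : ℝ) {g : ℝ × ℝ → ℝ}, Continuous g → Measurable (fun ξ => g (t, t * ξ)) :=
    fun t g hg => (hg.comp (by fun_prop : Continuous fun ξ : ℝ => (t, t * ξ))).measurable
  have hbig : ∀ {t ξ c : ℝ}, 0 < c → c ≤ t → M / c < |ξ| → M ≤ |t * ξ| := by
    intro t ξ c hc0 hct hξ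
    rw [div_lt_iff₀ hc0] at hξ
    rw [abs_mul, abs_of_pos (hc0.trans_le hct)]
    nlinarith [abs_nonneg ξ]
  -- integrability
  have int1 : ∀ t > 0, Integrable (fun ξ => |r ξ - k| * φ (t, t * ξ)) := by
    intro t ht
    refine integrable_of_bdd (hEm.mul (hcomp t hc)) (M / t) (R * C) (fun ξ hξ => ?_) fun ξ _ => ?_
    · rw [(hz t (t * ξ) (Or.inr (hbig ht le_rfl hξ))).1, mul_zero]
    · rw [abs_mul, abs_abs]
      exact mul_le_mul (habs _ (h.mem ξ)) (hb _).1 (abs_nonneg _) hR.le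
  have bd2 : ∀ c > 0, ∀ t ≥ c, ∀ ξ, |ξ| ≤ M / c →
      |(|r ξ - k| * (pdT φ (t, t * ξ) + ξ * pdX φ (t, t * ξ)))| ≤ R * (C + M / c * C) := by
    intro c hc0 t ht ξ hξ
    rw [abs_mul, abs_abs]
    refine mul_le_mul (habs _ (h.mem ξ)) ?_ (abs_nonneg _) hR.le
    refine (abs_add_le _ _).trans (add_le_add (hb _).2.1 ?_)
    rw [abs_mul]
    exact mul_le_mul hξ (hb _).2.2 (abs_nonneg _) (by positivity)
  have z2 : ∀ c > 0, ∀ t ≥ c, ∀ ξ, M / c < |ξ| →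
      |r ξ - k| * (pdT φ (t, t * ξ) + ξ * pdX φ (t, t * ξ)) = 0 := by
    intro c hc0 t ht ξ hξ
    have := hz t (t * ξ) (Or.inr (hbig hc0 ht hξ))
    rw [this.2.1, this.2.2]; simp
  have m2 : ∀ t, Measurable (fun ξ => |r ξ - k| * (pdT φ (t, t * ξ) + ξ * pdX φ (t, t * ξ))) :=
    fun t => hEm.mul ((hcomp t hcT).add (measurable_id.mul (hcomp t hcX)))
  have int2 : ∀ t > 0, Integrable
      (fun ξ => |r ξ - k| * (pdT φ (t, t * ξ) + ξ * pdX φ (t, t * ξ))) := fun t ht =>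
    integrable_of_bdd (m2 t) (M / t) _ (z2 t ht t le_rfl) (bd2 t ht t le_rfl)
  have int3 : ∀ t > 0, Integrable
      (fun ξ => |r ξ - k| * pdT φ (t, t * ξ) +
        Real.sign (r ξ - k) * (f (r ξ) - f k) * pdX φ (t, t * ξ)) := by
    intro t ht
    refine integrable_of_bdd ((hEm.mul (hcomp t hcT)).add (hrQm.mul (hcomp t hcX))) (M / t)
      (R * C + 2 * F * C) (fun ξ hξ => ?_) fun ξ _ => ?_
    · have := hz t (t * ξ) (Or.inr (hbig ht le_rfl hξ))
      rw [this.2.1, this.2.2]; simp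
    · refine (abs_add_le _ _).trans (add_le_add ?_ ?_)
      · rw [abs_mul, abs_abs]
        exact mul_le_mul (habs _ (h.mem ξ)) (hb _).2.1 (abs_nonneg _) hR.le
      · rw [abs_mul]
        exact mul_le_mul (hQ _ (h.mem ξ)) (hb _).2.2 (abs_nonneg _) (by positivity)
  -- derivative of A
  have hAd : ∀ t > 0, HasDerivAt A (A' t) t := by
    intro t ht
    have hB : HasDerivAt (fun t => ∫ ξ, |r ξ - k| * φ (t, t * ξ))
        (∫ ξ, |r ξ - k| * (pdT φ (t, t * ξ) + ξ * pdX φ (t, t * ξ))) t := by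
      have ht2 : 0 < t / 2 := by positivity
      refine (hasDerivAt_integral_of_dominated_loc_of_deriv_le (μ := volume)
        (F := fun t ξ => |r ξ - k| * φ (t, t * ξ))
        (F' := fun t ξ => |r ξ - k| * (pdT φ (t, t * ξ) + ξ * pdX φ (t, t * ξ)))
        (bound := (Icc (-(M / (t / 2))) (M / (t / 2))).indicator
          (fun _ => R * (C + M / (t / 2) * C)))
        (Ioi_mem_nhds (show t / 2 < t by linarith))
        (Eventually.of_forall fun s => (hEm.mul (hcomp s hc)).aestronglyMeasurable) (int1 t ht)
        (m2 t).aestronglyMeasurable (Eventually.of_forall fun ξ s hs => ?_) ?_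
        (Eventually.of_forall fun ξ s _ => (deriv_t hd s ξ).const_mul _)).2
      · have hs : t / 2 < s := hs
        by_cases hx : |ξ| ≤ M / (t / 2)
        · rw [indicator_of_mem (show ξ ∈ Icc _ _ from abs_le.1 hx)]
          exact bd2 _ ht2 s hs.le ξ hx
        · rw [indicator_of_notMem (show ξ ∉ Icc _ _ from fun hm => hx (abs_le.2 hm)),
            z2 _ ht2 s hs.le ξ (not_le.1 hx)]
          simp
      · rw [integrable_indicator_iff measurableSet_Icc]
        exact integrableOn_const (by simp)
    have h2 := (hasDerivAt_id t).mul hB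
    have h3 : A =ᶠ[nhds t] (id * fun t => ∫ ξ, |r ξ - k| * φ (t, t * ξ)) := by
      filter_upwards [Ioi_mem_nhds ht] with s hs
      have := scale_int (fun v x => |v - k| * φ (s, x)) hs r ρL ρR
      simpa using this
    refine (h2.congr_of_eventuallyEq h3).congr_deriv ?_
    simp [hA']
  have hpt : ∀ t > 0, A' t ≤ I t + 2 * ((1 - pbar / fmax) * f k * φ (t, 0)) := by
    intro t ht
    have hIt : I t = t * ∫ ξ, (|r ξ - k| * pdT φ (t, t * ξ) +
        Real.sign (r ξ - k) * (f (r ξ) - f k) * pdX φ (t, t * ξ)) :=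
      scale_int (fun v x => |v - k| * pdT φ (t, x) +
        Real.sign (v - k) * (f v - f k) * pdX φ (t, x)) ht r ρL ρR
    have hent := h.ent k hk (fun ξ => φ (t, t * ξ)) (fun ξ => t * pdX φ (t, t * ξ))
      (deriv_xi hd t) (by fun_prop) (fun ξ => hφ0 _) (M / t) (by positivity)
      (fun ξ hξ => (hz t (t * ξ) (Or.inr (by
        rw [div_le_iff₀ ht] at hξ; rw [abs_mul, abs_of_pos ht]; linarith))).1)
      (fun ξ hξ => by
        rw [(hz t (t * ξ) (Or.inr (by
        rw [div_le_iff₀ ht] at hξ; rw [abs_mul, abs_of_pos ht]; linarith))).2.2, mul_zero])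
    have e : (∫ ξ, (GG f k (r ξ) ξ * (t * pdX φ (t, t * ξ)) - |r ξ - k| * φ (t, t * ξ))) =
        I t - A' t := by
      have hs : Integrable (fun ξ => |r ξ - k| * φ (t, t * ξ) +
          t * (|r ξ - k| * (pdT φ (t, t * ξ) + ξ * pdX φ (t, t * ξ)))) :=
        (int1 t ht).add ((int2 t ht).const_mul t)
      rw [hIt, hA']
      simp only
      rw [← integral_const_mul, ← integral_const_mul, ← integral_add (int1 t ht) ((int2 t ht).const_mul t),
        ← integral_sub ((int3 t ht).const_mul t) hs]
      congr 1
      ext ξ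
      unfold GG
      ring
    rw [e] at hent
    simp only [mul_zero] at hent
    linarith
  -- measurability and bounds for I
  have hIm : StronglyMeasurable I := by
    refine StronglyMeasurable.integral_prod_right (f := fun t x => |sol r ρL ρR t x - k| * pdT φ (t, x) +
            Real.sign (sol r ρL ρR t x - k) * (f (sol r ρL ρR t x) - f k) * pdX φ (t, x)) ?_
    refine Measurable.stronglyMeasurable ?_
    have h1 := sol_meas h
    have h2 := hQm h1 (fun z => sol_mem h z.1 z.2)
    exact (((h1.sub_const k).abs).mul hcT.measurable).add (h2.mul hcX.measurable)
  have hIz : ∀ t, M ≤ |t| → I t = 0 := by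
    intro t ht
    have : ∀ x, pdT φ (t, x) = 0 ∧ pdX φ (t, x) = 0 := fun x => (hz t x (Or.inl ht)).2
    simp [hI, this]
  have hIb : ∀ t, |I t| ≤ (R * C + 2 * F * C) * (2 * M) := by
    intro t
    have e : I t = ∫ x in Icc (-M) M, (|sol r ρL ρR t x - k| * pdT φ (t, x) +
            Real.sign (sol r ρL ρR t x - k) * (f (sol r ρL ρR t x) - f k) * pdX φ (t, x)) := by
      refine (setIntegral_eq_integral_of_forall_compl_eq_zero fun x hx => ?_).symm
      have : M ≤ |x| := by
        by_contra hcon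
        exact hx (abs_le.1 (not_le.1 hcon).le)
      have := hz t x (Or.inr this)
      rw [this.2.1, this.2.2]; simp
    rw [e, ← Real.norm_eq_abs]
    have hv : volume.real (Icc (-M) M) = 2 * M := by
      rw [Real.volume_real_Icc_of_le (by linarith)]; ring
    rw [← hv]
    refine norm_setIntegral_le_of_norm_le_const (by simp) fun x _ => ?_
    refine (norm_add_le _ _).trans (add_le_add ?_ ?_)
    · rw [norm_mul, Real.norm_eq_abs, abs_abs]
      exact mul_le_mul (habs _ (sol_mem h t x)) (hb _).2.1 (abs_nonneg _) hR.le
    · rw [norm_mul]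
      exact mul_le_mul (hQ _ (sol_mem h t x)) (hb _).2.2 (abs_nonneg _) (by positivity)
  have hIint : Integrable I :=
    integrable_of_bdd hIm.measurable M _ (fun t ht => hIz t ht.le) (fun t _ => hIb t)
  have hJint : Integrable (fun t => (1 - pbar / fmax) * f k * φ (t, 0)) := by
    refine Integrable.const_mul ?_ _
    exact integrable_of_bdd (hc.comp (by fun_prop : Continuous fun t : ℝ => (t, (0:ℝ)))).measurable M C
      (fun t ht => (hz t 0 (Or.inl ht.le)).1) (fun t _ => (hb _).1)
  -- continuity of A
  have hAc : ContinuousOn A (Icc 0 M) := by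
    intro s hs
    rcases hs.1.eq_or_lt with rfl | hs0
    · have hm : ∀ t, Measurable (sol r ρL ρR t) := fun t => (sol_meas h).comp measurable_prodMk_left
      have hsub : Icc (0:ℝ) M ⊆ Ici 0 := fun x hx => hx.1
      refine Tendsto.mono_left ?_ (nhdsWithin_mono 0 hsub)
      refine tendsto_integral_filter_of_dominated_convergence
        ((Icc (-M) M).indicator (fun _ => R * C))
        (Eventually.of_forall fun t => ((((hm t).sub_const k).abs).mul
          (hc.comp (by fun_prop : Continuous fun x : ℝ => (t, x))).measurable).aestronglyMeasurable)
        (Eventually.of_forall fun t => Eventually.of_forall fun x => ?_) ?_ ?_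
      · by_cases hx : |x| ≤ M
        · rw [indicator_of_mem (show x ∈ Icc _ _ from abs_le.1 hx), norm_mul, Real.norm_eq_abs, abs_abs]
          exact mul_le_mul (habs _ (sol_mem h t x)) (hb _).1 (abs_nonneg _) hR.le
        · rw [indicator_of_notMem (show x ∉ Icc _ _ from fun hm => hx (abs_le.2 hm)),
            (hz t x (Or.inr (not_le.1 hx).le)).1]
          simp
      · rw [integrable_indicator_iff measurableSet_Icc]
        exact integrableOn_const (by simp)
      · filter_upwards [sol_cont h le_rfl] with x hx
        refine ((hx.sub_const k).abs).mul ?_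
        have : Continuous (fun t : ℝ => φ (t, x)) := by fun_prop
        exact (this.tendsto 0).mono_left nhdsWithin_le_nhds
    · exact (hAd s hs0).continuousAt.continuousWithinAt
  have hfin := intervalIntegral.sub_le_integral_of_hasDeriv_right_of_le hM.le hAc
    (fun t ht => (hAd t ht.1).hasDerivWithinAt)
    (φ := fun t => I t + 2 * ((1 - pbar / fmax) * f k * φ (t, 0)))
    ((hIint.add (hJint.const_mul 2)).integrableOn) (fun t ht => hpt t ht.1)
  have hAM : A M = 0 := by
    have : ∀ x, φ (M, x) = 0 := fun x => (hz M x (Or.inl (le_abs_self M))).1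
    simp [hA, this]
  have hA0 : A 0 = ∫ x, |riem ρL ρR x - k| * φ (0, x) := by
    simp [hA, sol]
  have hrest : ∀ g : ℝ → ℝ, (∀ t, M ≤ |t| → g t = 0) → ∫ t in Ioi (0:ℝ), g t = ∫ t in (0:ℝ)..M, g t := by
    intro g hg
    rw [intervalIntegral.integral_of_le hM.le]
    refine setIntegral_eq_of_subset_of_forall_sdiff_eq_zero measurableSet_Ioi
      (fun x hx => hx.1) fun t ht => ?_
    apply hg
    have h1 : ¬ t ≤ M := fun hle => ht.2 ⟨ht.1, hle⟩
    exact (not_le.1 h1).le.trans (le_abs_self t)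
  rw [hrest I hIz, hrest _ (fun t ht => by rw [(hz t 0 (Or.inl ht)).1, mul_zero]), ← hA0]
  rw [intervalIntegral.integral_add hIint.intervalIntegrable (hJint.const_mul 2).intervalIntegrable,
    intervalIntegral.integral_const_mul, hAM] at hfin
  linarith

end partC

section partE
lemma lip_mono {f : ℝ → ℝ} {a b R : ℝ} (ha : 0 ≤ a) (hb : b ≤ R) (hab : a ≤ b) {L : NNReal}
    (hL : LipschitzOnWith L f (Icc 0 R)) {P : ℝ → Prop}
    (hP : ∀ᵐ x ∂(volume.restrict (Icc (0:ℝ) R)), P x) :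
    (∀ᵐ x ∂(volume.restrict (Icc a b)), P x) ∧ ∫ x in a..b, deriv f x = f b - f a := by
  have hsub : Icc a b ⊆ Icc 0 R := Icc_subset_Icc ha hb
  refine ⟨ae_mono (Measure.restrict_mono hsub le_rfl) hP, ?_⟩
  have : AbsolutelyContinuousOnInterval f a b :=
    LipschitzOnWith.absolutelyContinuousOnInterval (K := L) (by rw [uIcc_of_le hab]; exact hL.mono hsub)
  exact this.integral_deriv_eq_sub

lemma AF_mono {R ρb : ℝ} {f : ℝ → ℝ} (hF : AF R ρb f) :
    MonotoneOn f (Icc 0 ρb) ∧ AntitoneOn f (Icc ρb R) := by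
  obtain ⟨hR, ⟨L, hL⟩, hnn, h0, hRR, hb, hd⟩ := hF
  constructor
  · intro x hx y hy hxy
    obtain ⟨h1, h2⟩ := lip_mono hx.1 (hy.2.trans hb.2.le) hxy hL hd
    have : 0 ≤ ∫ u in x..y, deriv f u := by
      rw [intervalIntegral.integral_of_le hxy]
      refine integral_nonneg_of_ae ?_
      have h1' := ae_mono (Measure.restrict_mono Ioc_subset_Icc_self le_rfl) h1
      filter_upwards [h1', ae_restrict_mem measurableSet_Ioc] with u hu hm
      have : u ≤ ρb := hm.2.trans hy.2
      simp only [Pi.zero_apply]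
      by_contra hcon
      nlinarith [not_le.1 hcon]
    linarith
  · intro x hx y hy hxy
    obtain ⟨h1, h2⟩ := lip_mono (hb.1.le.trans hx.1) hy.2 hxy hL hd
    have : 0 ≤ - ∫ u in x..y, deriv f u := by
      rw [intervalIntegral.integral_of_le hxy, ← integral_neg]
      refine integral_nonneg_of_ae ?_
      have h1' := ae_mono (Measure.restrict_mono Ioc_subset_Icc_self le_rfl) h1
      filter_upwards [h1', ae_restrict_mem measurableSet_Ioc] with u hu hm
      have : ρb ≤ u := hx.1.trans hm.1.le
      simp only [Pi.zero_apply]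
      by_contra hcon
      nlinarith [not_le.1 hcon]
    linarith

lemma mk_prof {R ρb : ℝ} {f : ℝ → ℝ} (hF : AF R ρb f) {ρL ρR pbar : ℝ}
    (hL : ρL ∈ Icc (0:ℝ) R) (hR' : ρR ∈ Icc (0:ℝ) R) (h1 : ρb < ρR)
    (hp0 : 0 < pbar) (hp1 : pbar ≤ f ρR)
    {a b : ℝ} (ha : 0 ≤ a) (hb : b ≤ R) (haR : ρR ≤ a) {r1 : ℝ → ℝ} (hr1 : GFan f a b r1)
    (hr10 : f (r1 0) = pbar) (V1 : ℝ) (hfar : ∀ ξ, ξ < -V1 → r1 ξ = ρL) :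
    ∃ (r2 : ℝ → ℝ) (lm lp V : ℝ), Prof R (f ρb) f (fun ξ => if ξ < 0 then r1 ξ else r2 ξ) ρL ρR pbar lm lp V := by
  obtain ⟨hmo, han⟩ := AF_mono hF
  obtain ⟨hR, ⟨L, hLip⟩, hnn, h0, hRR, hρb, hd⟩ := hF
  have hfc := hLip.continuousOn
  have hmax : ∀ k ∈ Icc (0:ℝ) R, f k ≤ f ρb := by
    intro k hk
    rcases le_total k ρb with h | h
    · exact hmo ⟨hk.1, h⟩ ⟨hρb.1.le, le_rfl⟩ h
    · exact han ⟨le_rfl, hρb.2.le⟩ ⟨h, hk.2⟩ h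
  have hpm : pbar ≤ f ρb := hp1.trans (hmax _ hR')
  obtain ⟨c, hc, hfc0⟩ : ∃ c ∈ Icc 0 ρb, f c = pbar :=
    intermediate_value_Icc hρb.1.le (hfc.mono (Icc_subset_Icc le_rfl hρb.2.le))
      ⟨by rw [h0]; exact hp0.le, hpm⟩
  have hcR : c ≤ ρR := hc.2.trans h1.le
  have hsub : Icc c ρR ⊆ Icc 0 R := Icc_subset_Icc hc.1 hR'.2
  have hsub1 : Icc a b ⊆ Icc 0 R := Icc_subset_Icc ha hb
  obtain ⟨r2, hr2⟩ := fan_exists hcR (hfc.mono hsub)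
  have hr20 : f (r2 0) = pbar := by
    have hm := (hr2 0).1
    have := (hr2 0).2 c ⟨le_rfl, hcR⟩
    apply le_antisymm
    · linarith
    · rcases le_total (r2 0) ρb with h | h
      · rw [← hfc0]; exact hmo hc ⟨hc.1.trans hm.1, h⟩ hm.1
      · exact hp1.trans (han ⟨h, hm.2.trans hR'.2⟩ ⟨h1.le, hR'.2⟩ hm.2)
  have hg2 : GFan f c ρR r2 := Or.inl hr2
  obtain ⟨lm, hlm, hflm⟩ := gfan_left hr1 (hfc.mono hsub1)
  obtain ⟨lp, hlp, hflp⟩ := gfan_right hg2 (hfc.mono hsub)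
  have e1 : r1 =ᶠ[nhdsWithin 0 (Iio 0)] (fun ξ => if ξ < 0 then r1 ξ else r2 ξ) := by
    filter_upwards [self_mem_nhdsWithin] with ξ hξ
    rw [if_pos (show ξ < 0 from hξ)]
  have e2 : r2 =ᶠ[nhdsWithin 0 (Ioi 0)] (fun ξ => if ξ < 0 then r1 ξ else r2 ξ) := by
    filter_upwards [self_mem_nhdsWithin] with ξ hξ
    rw [if_neg (not_lt.2 (le_of_lt hξ))]
  refine ⟨r2, lm, lp, |V1| + L + 1, ?_⟩
  constructor
  · exact hR
  · exact hL
  · exact hR'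
  · exact hfc
  · exact Measurable.ite measurableSet_Iio (gfan_meas hr1) (gfan_meas hg2)
  · intro ξ
    split_ifs
    · exact hsub1 (gfan_mem hr1 ξ)
    · exact hsub (hr2 ξ).1
  · refine (((gfan_countable hr1).union (gfan_countable hg2)).union (countable_singleton 0)).mono ?_
    intro x hx
    rcases lt_trichotomy x 0 with h | h | h
    · refine Or.inl (Or.inl fun hcon => hx (hcon.congr ?_))
      filter_upwards [Iio_mem_nhds h] with y hy
      rw [if_pos (show y < 0 from hy)]
    · exact Or.inr h
    · refine Or.inl (Or.inr fun hcon => hx (hcon.congr ?_))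
      filter_upwards [Ioi_mem_nhds h] with y hy
      rw [if_neg (not_lt.2 (le_of_lt hy))]
  · positivity
  · intro ξ hξ
    have := le_abs_self V1
    have hL0 : (0:ℝ) ≤ L := L.2
    have := abs_nonneg V1
    rw [if_pos (by linarith)]
    exact hfar ξ (by linarith)
  · intro ξ hξ
    have := abs_nonneg V1
    have hL0 : (0:ℝ) ≤ L := L.2
    rw [if_neg (by linarith)]
    exact fan_far_right hr2 hcR (hLip.mono hsub) (by linarith)
  · exact hlm.congr' e1
  · exact hlp.congr' e2
  · rw [hflm, hr10]
  · rw [hflp, hr20]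
  · exact hsub1 (isClosed_Icc.mem_of_tendsto hlm (Eventually.of_forall fun ξ => gfan_mem hr1 ξ))
  · exact hsub (isClosed_Icc.mem_of_tendsto hlp (Eventually.of_forall fun ξ => gfan_mem hg2 ξ))
  · intro k hk ψ ψ' hψ hc' hψ0 M hM hz hz'
    exact oneD hr1 hg2 hp0.le hr10 hr20 ((hr2 0).1.2.trans (haR.trans (gfan_mem hr1 0).1)) hmax hnn hpm
      (hp0.trans_le hpm) hk hψ hc' hψ0 hM hz hz'

section avg
variable {R fmax : ℝ} {f r : ℝ → ℝ} {ρL ρR pbar lm lp V : ℝ} {w : ℝ → ℝ}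

lemma w_int (hW : AW w) : IntegrableOn w (Iic 0) := by
  by_contra h
  have := hW.2.2.1
  rw [integral_undef h] at this
  exact zero_ne_one this

lemma wr_int (hW : AW w) (h : Prof R fmax f r ρL ρR pbar lm lp V) (t : ℝ) :
    IntegrableOn (fun x => w x * sol r ρL ρR t x) (Iic 0) := by
  have hm : Measurable (sol r ρL ρR t) := (sol_meas h).comp measurable_prodMk_left
  refine Integrable.mul_bdd (c := R) (w_int hW) hm.aestronglyMeasurable
    (Eventually.of_forall fun x => ?_)
  have := sol_mem h t x
  rw [Real.norm_eq_abs, abs_of_nonneg this.1]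
  exact this.2

lemma wAvg_tendsto (hW : AW w) (h : Prof R fmax f r ρL ρR pbar lm lp V) :
    Tendsto (wAvg w (sol r ρL ρR)) (nhdsWithin 0 (Ioi 0)) (nhds ρL) := by
  have e : ρL = ∫ x in Iic (0:ℝ), w x * ρL := by
    rw [integral_mul_const, hW.2.2.1, one_mul]
  unfold wAvg
  suffices Tendsto (fun t => ∫ x in Iic (0:ℝ), w x * sol r ρL ρR t x) (nhdsWithin 0 (Ioi 0))
      (nhds (∫ x in Iic (0:ℝ), w x * ρL)) by
    rwa [← e] at this
  refine tendsto_integral_filter_of_dominated_convergence (fun x => w x * R)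
    (Eventually.of_forall fun t => (wr_int hW h t).aestronglyMeasurable)
    (Eventually.of_forall fun t => ?_) ((w_int hW).mul_const R) ?_
  · filter_upwards [ae_restrict_mem measurableSet_Iic] with x hx
    have := sol_mem h t x
    rw [norm_mul, Real.norm_eq_abs, Real.norm_eq_abs, abs_of_nonneg this.1, abs_of_nonneg (hW.1 x hx)]
    exact mul_le_mul_of_nonneg_left this.2 (hW.1 x hx)
  · have hne : ∀ᵐ x ∂(volume.restrict (Iic (0:ℝ))), x ≠ 0 :=
      ae_restrict_of_ae (by simp [ae_iff])
    filter_upwards [ae_restrict_mem measurableSet_Iic, hne] with x hx hx0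
    have hlt : x < 0 := lt_of_le_of_ne hx hx0
    refine tendsto_const_nhds.congr' ?_
    filter_upwards [(sol_near0 h hx0).filter_mono (nhdsWithin_mono 0 Ioi_subset_Ici_self)] with t ht
    rw [ht, riem, if_pos hlt]

lemma wAvg_ge (hW : AW w) (h : Prof R fmax f r ρL ρR pbar lm lp V) (hr : ∀ ξ < 0, ρL ≤ r ξ)
    {t : ℝ} (ht : 0 < t) : ρL ≤ wAvg w (sol r ρL ρR) t := by
  have e : ρL = ∫ x in Iic (0:ℝ), w x * ρL := by
    rw [integral_mul_const, hW.2.2.1, one_mul]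
  conv_lhs => rw [e]
  refine integral_mono_ae ((w_int hW).mul_const _) (wr_int hW h t) ?_
  have hne : ∀ᵐ x ∂(volume.restrict (Iic (0:ℝ))), x ≠ 0 :=
      ae_restrict_of_ae (by simp [ae_iff])
  filter_upwards [ae_restrict_mem measurableSet_Iic, hne] with x hx hx0
  have hlt : x < 0 := lt_of_le_of_ne hx hx0
  refine mul_le_mul_of_nonneg_left ?_ (hW.1 x hx)
  unfold sol
  rw [if_neg (not_le.2 ht)]
  exact hr _ (div_neg_of_neg_of_pos hlt ht)

lemma wAvg_le (hW : AW w) (h : Prof R fmax f r ρL ρR pbar lm lp V) (hr : ∀ ξ < 0, r ξ ≤ ρL)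
    {t : ℝ} (ht : 0 < t) : wAvg w (sol r ρL ρR) t ≤ ρL := by
  have e : ρL = ∫ x in Iic (0:ℝ), w x * ρL := by
    rw [integral_mul_const, hW.2.2.1, one_mul]
  conv_rhs => rw [e]
  refine integral_mono_ae (wr_int hW h t) ((w_int hW).mul_const _) ?_
  have hne : ∀ᵐ x ∂(volume.restrict (Iic (0:ℝ))), x ≠ 0 :=
      ae_restrict_of_ae (by simp [ae_iff])
  filter_upwards [ae_restrict_mem measurableSet_Iic, hne] with x hx hx0
  have hlt : x < 0 := lt_of_le_of_ne hx hx0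
  refine mul_le_mul_of_nonneg_left ?_ (hW.1 x hx)
  unfold sol
  rw [if_neg (not_le.2 ht)]
  exact hr _ (div_neg_of_neg_of_pos hlt ht)

lemma mk_sol {p : ℝ → ℝ} (hp0 : 0 ≤ pbar) (hpm : pbar ≤ fmax)
    (h : Prof R fmax f r ρL ρR pbar lm lp V)
    {T : ℝ} (hq : ∀ t, 0 < t → t < T → pbar ∈ Icc (pplus R p (wAvg w (sol r ρL ρR) t))
      (pminus p (wAvg w (sol r ρL ρR) t))) :
    EWSolOn R fmax T f w p (riem ρL ρR) (sol r ρL ρR) (fun _ => lm) (fun _ => lp) := by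
  refine ⟨fun _ => pbar, ⟨sol_reg h, fun _ => ⟨hp0, hpm⟩, ?_, sol_left h, sol_right h, ?_⟩, ?_⟩
  · intro φ hφ hφ0 _ k hk
    exact sol_ent h φ hφ hφ0 k hk
  · exact Eventually.of_forall fun t => ⟨h.fl.le, h.fr.le⟩
  · filter_upwards [ae_restrict_mem measurableSet_Ioo] with t ht
    exact hq t ht.1 ht.2

lemma not_ae {r' : ℝ → ℝ} {pbar' lm' lp' V' : ℝ} (h : Prof R fmax f r ρL ρR pbar lm lp V)
    (h' : Prof R fmax f r' ρL ρR pbar' lm' lp' V') (hne : pbar ≠ pbar') {τ : ℝ} (hτ : 0 < τ) :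
    ¬ aeEqOn τ (sol r ρL ρR) (sol r' ρL ρR) := by
  intro hae
  have hl : lp ≠ lp' := fun hl => hne (by rw [← h.fr, ← h'.fr, hl])
  have hev : ∀ᶠ ξ in nhdsWithin (0:ℝ) (Ioi 0), r ξ ≠ r' ξ := by
    have := (h.tr.sub h'.tr).eventually_ne (sub_ne_zero.2 hl)
    filter_upwards [this] with ξ hξ
    exact sub_ne_zero.1 hξ
  obtain ⟨δ, hδ, hδ'⟩ := mem_nhdsGT_iff_exists_Ioo_subset.1 hev
  have hδ0 : (0:ℝ) < δ := hδ
  set U : Set (ℝ × ℝ) := {z | 0 < z.1 ∧ z.1 < τ ∧ 0 < z.2 ∧ z.2 < δ * z.1} with hU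
  have hUo : IsOpen U := by
    have c1 : Continuous fun z : ℝ × ℝ => z.1 := continuous_fst
    have c2 : Continuous fun z : ℝ × ℝ => z.2 := continuous_snd
    exact (isOpen_lt continuous_const c1).inter ((isOpen_lt c1 continuous_const).inter
      ((isOpen_lt continuous_const c2).inter (isOpen_lt c2 (continuous_const.mul c1))))
  have hUn : U.Nonempty := ⟨(τ / 2, δ * (τ / 2) / 2), by
    have : 0 < δ * (τ / 2) := by positivity
    refine ⟨?_, ?_, ?_, ?_⟩ <;> simp only <;> linarith⟩
  have hpos := hUo.measure_pos (volume : Measure (ℝ × ℝ)) hUn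
  unfold aeEqOn at hae
  rw [ae_restrict_iff' (measurableSet_Ioo.prod MeasurableSet.univ), ae_iff] at hae
  refine hpos.ne' (measure_mono_null ?_ hae)
  intro z hz
  obtain ⟨a1, a2, a3, a4⟩ := hz
  simp only [mem_ofPred_eq, not_forall]
  refine ⟨⟨⟨a1, a2⟩, mem_univ _⟩, ?_⟩
  unfold sol
  rw [if_neg (not_le.2 a1), if_neg (not_le.2 a1)]
  exact hδ' ⟨div_pos a3 a1, by rw [div_lt_iff₀ a1]; exact a4⟩

end avg

end partE

section partG
lemma pplus_attained {R fmax ξ : ℝ} {p : ℝ → ℝ} (hP : AP2 R fmax p) (h0 : 0 ≤ ξ) (h : ξ < R) :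
    ∃ y ∈ Ioc ξ R, p y = pplus R p ξ := by
  have hne : (p '' Ioc ξ R).Nonempty := ⟨p R, R, ⟨h, le_rfl⟩, rfl⟩
  have hfin : (p '' Ioc ξ R).Finite :=
    hP.2.2.subset (image_mono fun x hx => ⟨h0.trans hx.1.le, hx.2⟩)
  have := hne.csSup_mem hfin
  rw [pplus, if_neg (not_le.2 h)]
  obtain ⟨y, hy, e⟩ := this
  exact ⟨y, hy, e⟩

lemma pminus_attained {R fmax ξ : ℝ} {p : ℝ → ℝ} (hP : AP2 R fmax p) (h0 : 0 < ξ) (h : ξ ≤ R) :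
    ∃ y ∈ Ico 0 ξ, p y = pminus p ξ := by
  have hne : (p '' Ico 0 ξ).Nonempty := ⟨p 0, 0, ⟨le_rfl, h0⟩, rfl⟩
  have hfin : (p '' Ico 0 ξ).Finite :=
    hP.2.2.subset (image_mono fun x hx => ⟨hx.1, hx.2.le.trans h⟩)
  have := hne.csInf_mem hfin
  rw [pminus, if_neg (not_le.2 h0)]
  obtain ⟨y, hy, e⟩ := this
  exact ⟨y, hy, e⟩

lemma pplus_le {R fmax ξ y : ℝ} {p : ℝ → ℝ} (hP : AP2 R fmax p) (h0 : 0 ≤ y) (hy : y ≤ ξ) (h : ξ < R) :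
    pplus R p ξ ≤ p y := by
  rw [pplus, if_neg (not_le.2 h)]
  refine csSup_le ⟨p R, R, ⟨h, le_rfl⟩, rfl⟩ ?_
  rintro _ ⟨z, hz, rfl⟩
  exact hP.1 ⟨h0, hy.trans h.le⟩ ⟨(h0.trans hy).trans hz.1.le, hz.2⟩ (hy.trans hz.1.le)

lemma le_pminus {R fmax ξ y : ℝ} {p : ℝ → ℝ} (hP : AP2 R fmax p) (h0 : 0 < ξ) (hy : ξ ≤ y) (h : y ≤ R) :
    p y ≤ pminus p ξ := by
  rw [pminus, if_neg (not_le.2 h0)]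
  refine le_csInf ⟨p 0, 0, ⟨le_rfl, h0⟩, rfl⟩ ?_
  rintro _ ⟨z, hz, rfl⟩
  exact hP.1 ⟨hz.1, (hz.2.le.trans hy).trans h⟩ ⟨h0.le.trans hy, h⟩ (hz.2.le.trans hy)

lemma pplus_anti {R fmax ξ y : ℝ} {p : ℝ → ℝ} (hP : AP2 R fmax p) (h0 : 0 ≤ y) (hy : y ≤ ξ) (h : ξ < R) :
    pplus R p ξ ≤ pplus R p y := by
  rw [pplus, if_neg (not_le.2 h), pplus, if_neg (not_le.2 (hy.trans_lt h))]
  have hfin : (p '' Ioc y R).Finite :=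
    hP.2.2.subset (image_mono fun x hx => ⟨h0.trans hx.1.le, hx.2⟩)
  exact csSup_le_csSup hfin.bddAbove ⟨p R, R, ⟨h, le_rfl⟩, rfl⟩
    (image_mono (Ioc_subset_Ioc_left hy))

lemma pminus_anti {R fmax ξ y : ℝ} {p : ℝ → ℝ} (hP : AP2 R fmax p) (h0 : 0 < ξ) (hy : ξ ≤ y) (h : y ≤ R) :
    pminus p y ≤ pminus p ξ := by
  rw [pminus, if_neg (not_le.2 (h0.trans_le hy)), pminus, if_neg (not_le.2 h0)]
  have hfin : (p '' Ico 0 y).Finite :=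
    hP.2.2.subset (image_mono fun x hx => ⟨hx.1, hx.2.le.trans h⟩)
  exact csInf_le_csInf hfin.bddBelow ⟨p 0, 0, ⟨le_rfl, h0⟩, rfl⟩
    (image_mono (Ico_subset_Ico_right hy))

/-- Left fan for constraint values not larger than `f ρL` (the state grows towards the constraint). -/
lemma left_up {R ρb : ℝ} {f : ℝ → ℝ} (hF : AF R ρb f) {ρL ρR pbar : ℝ}
    (hL : ρL ∈ Icc (0:ℝ) R) (hR' : ρR ∈ Icc (0:ℝ) R) (h1 : ρb < ρR) (h2 : ρR < ρL)
    (hp0 : 0 < pbar) (hp1 : pbar ≤ f ρL) :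
    ∃ (r : ℝ → ℝ) (lm lp V : ℝ), Prof R (f ρb) f r ρL ρR pbar lm lp V ∧ (∀ ξ < 0, ρL ≤ r ξ) ∧
      (pbar = f ρL → ∀ ξ < 0, r ξ = ρL) := by
  obtain ⟨hmo, han⟩ := AF_mono hF
  obtain ⟨hR, ⟨L, hLip⟩, hnn, h0, hRR, hρb, hd⟩ := id hF
  have hfc := hLip.continuousOn
  have hbL : ρb ≤ ρL := (h1.trans h2).le
  have hc : ∃ c ∈ Icc ρL R, f c = pbar ∧ (pbar = f ρL → c = ρL) := by
    by_cases he : pbar = f ρL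
    · exact ⟨ρL, ⟨le_rfl, hL.2⟩, he.symm, fun _ => rfl⟩
    · obtain ⟨c, hc, e⟩ := intermediate_value_Icc' hL.2 (hfc.mono (Icc_subset_Icc hL.1 le_rfl))
        (show pbar ∈ Icc (f R) (f ρL) from ⟨by rw [hRR]; exact hp0.le, hp1⟩)
      exact ⟨c, hc, e, fun h => absurd h he⟩
  obtain ⟨c, hc, hfc0, hceq⟩ := hc
  have hsub : Icc ρL c ⊆ Icc 0 R := Icc_subset_Icc hL.1 hc.2
  obtain ⟨r1, hr1⟩ := fan_exists hc.1 (hfc.mono hsub)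
  have hr10 : f (r1 0) = pbar := by
    have hm := (hr1 0).1
    have := (hr1 0).2 c ⟨hc.1, le_rfl⟩
    apply le_antisymm
    · linarith
    · rw [← hfc0]
      exact han ⟨hbL.trans hm.1, hm.2.trans hc.2⟩ ⟨hbL.trans hc.1, hc.2⟩ hm.2
  have h12 : f ρL ≤ f ρR := han ⟨h1.le, hR'.2⟩ ⟨hbL, hL.2⟩ h2.le
  obtain ⟨r2, lm, lp, V, hprof⟩ := mk_prof hF hL hR' h1 hp0 (hp1.trans h12) hL.1 hc.2 h2.le
    (Or.inl hr1) hr10 L (fun ξ hξ => fan_far_left hr1 hc.1 (hLip.mono hsub) hξ)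
  refine ⟨_, lm, lp, V, hprof, fun ξ hξ => ?_, fun he ξ hξ => ?_⟩
  · simp only [hξ, if_true]
    exact (hr1 ξ).1.1
  · simp only [hξ, if_true]
    have := (hr1 ξ).1
    exact le_antisymm (by rw [← hceq he]; exact (hceq he ▸ this.2 : r1 ξ ≤ ρL).trans (hceq he).ge) this.1

/-- Left fan for constraint values between `f ρL` and `f ρR`. -/
lemma left_down {R ρb : ℝ} {f : ℝ → ℝ} (hF : AF R ρb f) {ρL ρR pbar : ℝ}
    (hL : ρL ∈ Icc (0:ℝ) R) (hR' : ρR ∈ Icc (0:ℝ) R) (h1 : ρb < ρR) (h2 : ρR < ρL)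
    (hp0 : 0 < pbar) (hp1 : f ρL ≤ pbar) (hp2 : pbar ≤ f ρR) :
    ∃ (r : ℝ → ℝ) (lm lp V : ℝ), Prof R (f ρb) f r ρL ρR pbar lm lp V ∧ (∀ ξ < 0, r ξ ≤ ρL) := by
  obtain ⟨hmo, han⟩ := AF_mono hF
  obtain ⟨hR, ⟨L, hLip⟩, hnn, h0, hRR, hρb, hd⟩ := id hF
  have hfc := hLip.continuousOn
  obtain ⟨c, hc, hfc0⟩ := intermediate_value_Icc' h2.le (hfc.mono (Icc_subset_Icc hR'.1 hL.2))
        (show pbar ∈ Icc (f ρL) (f ρR) from ⟨hp1, hp2⟩)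
  have hsub : Icc c ρL ⊆ Icc 0 R := Icc_subset_Icc (hR'.1.trans hc.1) hL.2
  have hLip' : LipschitzOnWith L (fun u => - f (-u)) (Icc (-ρL) (-c)) := by
    rw [lipschitzOnWith_iff_dist_le_mul] at hLip ⊢
    intro x hx y hy
    have := hLip (-x) (hsub ⟨by linarith [hx.2], by linarith [hx.1]⟩) (-y)
      (hsub ⟨by linarith [hy.2], by linarith [hy.1]⟩)
    rwa [dist_neg_neg, ← dist_neg_neg x y]
  have hle : -ρL ≤ -c := by linarith [hc.2]
  obtain ⟨s, hs⟩ := fan_exists hle hLip'.continuousOn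
  have hs' : Fan (fun u => - f (-u)) (-ρL) (-c) (fun ξ => - (fun ξ => - s ξ) ξ) := by
    simpa using hs
  have hr1 : GFan f c ρL (fun ξ => - s ξ) := Or.inr hs'
  have hr10 : f (- s 0) = pbar := by
    have hm := (hs 0).1
    have := (hs 0).2 (-c) ⟨hle, le_rfl⟩
    simp only [neg_neg] at this
    apply le_antisymm
    · rw [← hfc0]
      exact han ⟨h1.le.trans hc.1, hc.2.trans hL.2⟩
        ⟨by linarith [hm.2, hc.1], by linarith [hm.1, hL.2]⟩ (by linarith [hm.2])
    · linarith
  obtain ⟨r2, lm, lp, V, hprof⟩ := mk_prof hF hL hR' h1 hp0 hp2 (hR'.1.trans hc.1) hL.2 hc.1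
    hr1 hr10 L (fun ξ hξ => by
      simp only [fan_far_left hs hle hLip' hξ, neg_neg])
  refine ⟨_, lm, lp, V, hprof, fun ξ hξ => ?_⟩
  simp only [hξ, if_true]
  exact (gfan_mem hr1 ξ).2

lemma core {R ρb : ℝ} {f w p : ℝ → ℝ} (hF : AF R ρb f) (hW : AW w)
    (hP : AP2 R (f ρb) p) {ρL ρR : ℝ} (hL : ρL ∈ Icc (0:ℝ) R) (hR' : ρR ∈ Icc (0:ℝ) R)
    (h1 : ρb < ρR) (h2 : ρR < ρL)
    (h3 : pminus p ρL < f ρR) (h4 : f ρL ≤ pminus p ρL) (h5 : pplus R p ρL ≤ f ρL)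
    {pbar : ℝ} (hpb : pbar ∈ ({pplus R p ρL, f ρL, pminus p ρL} : Set ℝ)) :
    ∃ T > (0:ℝ), ∃ (r : ℝ → ℝ) (lm lp V : ℝ), Prof R (f ρb) f r ρL ρR pbar lm lp V ∧
      ∀ T' ≤ T, EWSolOn R (f ρb) T' f w p (riem ρL ρR) (sol r ρL ρR) (fun _ => lm) (fun _ => lp) := by
  obtain ⟨hmo, han⟩ := AF_mono hF
  obtain ⟨hR, ⟨L, hLip⟩, hnn, h0, hRR, hρb, hd⟩ := id hF
  have hL0 : 0 < ρL := hρb.1.trans (h1.trans h2)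
  have hLR : ρL < R := by
    refine lt_of_le_of_ne hL.2 fun he => ?_
    rw [pplus, if_pos he.ge, he, hRR] at h5
    exact absurd (hP.2.1 R ⟨hR.le, le_rfl⟩).1 (not_lt.2 h5)
  obtain ⟨y1, hy1, e1⟩ := pplus_attained hP hL0.le hLR
  obtain ⟨y2, hy2, e2⟩ := pminus_attained hP hL0 hL.2
  have hpp : 0 < pplus R p ρL := e1 ▸ (hP.2.1 y1 ⟨hL0.le.trans hy1.1.le, hy1.2⟩).1
  have hRb : f ρR ≤ f ρb := han ⟨le_rfl, hρb.2.le⟩ ⟨h1.le, hR'.2⟩ h1.le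
  have fromT : ∀ {r : ℝ → ℝ} {lm lp V : ℝ}, 0 < pbar → pbar ≤ f ρb →
      Prof R (f ρb) f r ρL ρR pbar lm lp V →
      (∀ᶠ t in nhdsWithin (0:ℝ) (Ioi 0), pbar ∈ Icc (pplus R p (wAvg w (sol r ρL ρR) t))
        (pminus p (wAvg w (sol r ρL ρR) t))) →
      ∃ T > (0:ℝ), ∃ (r : ℝ → ℝ) (lm lp V : ℝ), Prof R (f ρb) f r ρL ρR pbar lm lp V ∧
      ∀ T' ≤ T, EWSolOn R (f ρb) T' f w p (riem ρL ρR) (sol r ρL ρR) (fun _ => lm) (fun _ => lp) := by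
    intro r lm lp V hp hp' hprof hev
    obtain ⟨T, hT, hsub⟩ := mem_nhdsGT_iff_exists_Ioo_subset.1 hev
    exact ⟨T, hT, r, lm, lp, V, hprof, fun T' hT' =>
      mk_sol hp.le hp' hprof fun t ht ht' => hsub ⟨ht, ht'.trans_le hT'⟩⟩
  rcases hpb with rfl | rfl | hpb
  · obtain ⟨r, lm, lp, V, hprof, hge, -⟩ := left_up hF hL hR' h1 h2 hpp h5
    refine fromT hpp ((h5.trans h4).trans (h3.le.trans hRb)) hprof ?_
    filter_upwards [self_mem_nhdsWithin, (wAvg_tendsto hW hprof).eventually_lt_const hy1.1] with t ht hlt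
    have hle := wAvg_ge hW hprof hge ht
    refine ⟨pplus_anti hP hL0.le hle (hlt.trans_le hy1.2), ?_⟩
    rw [← e1]
    exact le_pminus hP (hL0.trans_le hle) hlt.le hy1.2
  · obtain ⟨r, lm, lp, V, hprof, hge, heq⟩ := left_up hF hL hR' h1 h2 (hpp.trans_le h5) le_rfl
    refine fromT (hpp.trans_le h5) (h4.trans (h3.le.trans hRb)) hprof ?_
    filter_upwards [self_mem_nhdsWithin] with t ht
    have hle := wAvg_ge hW hprof hge ht
    have hle' := wAvg_le hW hprof (fun ξ hξ => (heq rfl ξ hξ).le) ht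
    rw [le_antisymm hle' hle]
    exact ⟨h5, h4⟩
  · obtain rfl : pbar = pminus p ρL := hpb
    have hp0 := hpp.trans_le (h5.trans h4)
    obtain ⟨r, lm, lp, V, hprof, hge⟩ := left_down hF hL hR' h1 h2 hp0 h4 h3.le
    refine fromT hp0 (h3.le.trans hRb) hprof ?_
    filter_upwards [self_mem_nhdsWithin, (wAvg_tendsto hW hprof).eventually_const_lt hy2.2] with t ht hlt
    have hle := wAvg_le hW hprof hge ht
    refine ⟨?_, pminus_anti hP (hy2.1.trans_lt hlt) hle hL.2⟩
    rw [← e2]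
    exact pplus_le hP hy2.1 hlt.le (hle.trans_lt hLR)

end partG

/-- in case (NNN5), for each `p̄ ∈ {p(ρL+), f ρL, p(ρL−)}` the constrained
Riemann problem admits (locally in time) an entropy weak solution with boundary flux `p̄`;
in particular it admits at least two solutions that do not coincide for small times. -/
theorem stmt12 (R ρb : ℝ) (f w p : ℝ → ℝ) (hF : AF R ρb f) (hW : AW w)
    (hP : AP2 R (f ρb) p) (ρL ρR : ℝ) (hL : ρL ∈ Icc (0:ℝ) R) (hR' : ρR ∈ Icc (0:ℝ) R)
    (h1 : ρb < ρR) (h2 : ρR < ρL)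
    (h3 : pminus p ρL < f ρR) (h4 : f ρL ≤ pminus p ρL) (h5 : pplus R p ρL ≤ f ρL)
    (h6 : pminus p ρL ≠ pplus R p ρL) :
    (∀ pbar ∈ ({pplus R p ρL, f ρL, pminus p ρL} : Set ℝ),
      ∃ T > (0:ℝ), ∃ ρ : ℝ → ℝ → ℝ, ∃ γm γp : ℝ → ℝ,
        EWSolOn R (f ρb) T f w p (riem ρL ρR) ρ γm γp ∧
        ∀ᵐ t ∂(volume.restrict (Ioo (0:ℝ) T)), f (γm t) = pbar ∧ f (γp t) = pbar) ∧
    ∃ T > (0:ℝ), ∃ ρ1 ρ2 : ℝ → ℝ → ℝ, ∃ γm1 γp1 γm2 γp2 : ℝ → ℝ,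
      EWSolOn R (f ρb) T f w p (riem ρL ρR) ρ1 γm1 γp1 ∧
      EWSolOn R (f ρb) T f w p (riem ρL ρR) ρ2 γm2 γp2 ∧
      ∀ τ ∈ Ioc (0:ℝ) T, ¬ aeEqOn τ ρ1 ρ2 := by
  constructor
  · intro pbar hpb
    obtain ⟨T, hT, r, lm, lp, V, hprof, hsol⟩ := core hF hW hP hL hR' h1 h2 h3 h4 h5 hpb
    exact ⟨T, hT, _, _, _, hsol T le_rfl, Eventually.of_forall fun t => ⟨hprof.fl, hprof.fr⟩⟩
  · obtain ⟨T, hT, r, lm, lp, V, hprof, hsol⟩ :=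
      core hF hW hP hL hR' h1 h2 h3 h4 h5 (pbar := pminus p ρL) (by simp)
    obtain ⟨T', hT', r', lm', lp', V', hprof', hsol'⟩ :=
      core hF hW hP hL hR' h1 h2 h3 h4 h5 (pbar := pplus R p ρL) (by simp)
    exact ⟨min T T', lt_min hT hT', _, _, _, _, _, _, hsol _ (min_le_left _ _),
      hsol' _ (min_le_right _ _), fun τ hτ => not_ae hprof hprof' h6 hτ.1⟩

end

end CRP
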